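/- There exist an irrational number α ∈ ℝ, a radius r > 0, and a holomorphic injective map f defined on an open neighborhood of the closed disk D̄_r with f(0) = 0 and f'(0) = e^{2πiα}, such that f is non-linearizable and f admits a hedgehog K on D̄_r whose two-dimensional Lebesgue measure is strictly positive. -/

import Mathlib

open Complex Metric Set Filter MeasureTheory

noncomputable section

/-- `f` is linearizable at the origin with rotation number `α`: there is a holomorphic
injective map `h` on a neighborhood of `0` with `h 0 = 0` conjugating `f` to the rigid
rotation `z ↦ e^{2πiα} z` near `0`. -/
def Linearizable (α : ℝ) (f : ℂ → ℂ) : Prop :=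
  ∃ (h : ℂ → ℂ) (V : Set ℂ), IsOpen V ∧ (0 : ℂ) ∈ V ∧
    DifferentiableOn ℂ h V ∧ Set.InjOn h V ∧ h 0 = 0 ∧
    ∀ᶠ z in nhds (0 : ℂ), f (h z) = h (Complex.exp (2 * Real.pi * Complex.I * α) * z)

/-- `K` is a hedgehog for `f` on the closed disk of radius `r`: a compact connected set
containing `0`, contained in the closed disk, touching the boundary circle,
totally invariant (`f(K) = K`), and with connected complement. -/
def IsHedgehog (r : ℝ) (f : ℂ → ℂ) (K : Set ℂ) : Prop :=
  IsCompact K ∧ IsConnected K ∧ (0 : ℂ) ∈ K ∧ K ⊆ Metric.closedBall 0 r ∧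
    (K ∩ Metric.sphere 0 r).Nonempty ∧ f '' K = K ∧ IsConnected Kᶜ

open Topology in
/-- The intersection of a decreasing sequence of compact preconnected sets is preconnected. -/
theorem isPreconnected_iInter_of_antitone {X : Type*} [TopologicalSpace X] [T2Space X]
    {K : ℕ → Set X} (hanti : Antitone K) (hcomp : ∀ n, IsCompact (K n))
    (hconn : ∀ n, IsPreconnected (K n)) : IsPreconnected (⋂ n, K n) := by
  have hclosed : IsClosed (⋂ n, K n) := isClosed_iInter fun n => (hcomp n).isClosed
  have hc : IsCompact (⋂ n, K n) :=
    (hcomp 0).of_isClosed_subset hclosed (iInter_subset _ 0)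
  rw [isPreconnected_iff_subset_of_disjoint_closed]
  intro A B hA hB hAB hdisj
  have hd : Disjoint ((⋂ n, K n) ∩ A) ((⋂ n, K n) ∩ B) := by
    rw [Set.disjoint_iff_inter_eq_empty, ← hdisj]
    ext x; simp only [mem_inter_iff]; tauto
  obtain ⟨U, V, hU, hV, hAU, hBV, hUV⟩ :=
    SeparatedNhds.of_isCompact_isCompact (hc.inter_right hA) (hc.inter_right hB) hd
  have hsub : (⋂ n, K n) ⊆ U ∪ V := by
    intro x hx
    rcases hAB hx with h | h
    · exact Or.inl (hAU ⟨hx, h⟩)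
    · exact Or.inr (hBV ⟨hx, h⟩)
  obtain ⟨n, hn⟩ := exists_subset_nhds_of_isCompact' (directed_of_isDirected_le hanti) hcomp
    (fun n => (hcomp n).isClosed) fun x hx => (hU.union hV).mem_nhds (hsub hx)
  rcases (hconn n).subset_or_subset hU hV hUV hn with h | h
  · left
    intro x hx
    rcases hAB hx with h' | h'
    · exact h'
    · exact (Set.disjoint_left.1 hUV (h (mem_iInter.1 hx n)) (hBV ⟨hx, h'⟩)).elim
  · right
    intro x hx
    rcases hAB hx with h' | h'
    · exact (Set.disjoint_left.1 hUV (hAU ⟨hx, h'⟩) (h (mem_iInter.1 hx n))).elim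
    · exact h'

/-- A closed set has connected complement as soon as a deleted open neighbourhood is connected. -/
theorem isConnected_compl_of_diff {K V : Set ℂ} (hK : IsClosed K) (hne : K.Nonempty)
    (hV : IsOpen V) (hKV : K ⊆ V) (hc : IsConnected (V \ K)) : IsConnected Kᶜ := by
  obtain ⟨y, hy⟩ := hc.nonempty
  refine ⟨⟨y, hy.2⟩, isPreconnected_of_forall y fun z hz => ?_⟩
  have hCopen : IsOpen (connectedComponentIn Kᶜ z) := hK.isOpen_compl.connectedComponentIn
  have hmeet : (connectedComponentIn Kᶜ z ∩ (V \ K)).Nonempty := by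
    by_contra hcon
    rw [Set.not_nonempty_iff_eq_empty] at hcon
    have hCV : Disjoint (connectedComponentIn Kᶜ z) V := by
      rw [Set.disjoint_left]
      intro x hx hxV
      have : x ∈ connectedComponentIn Kᶜ z ∩ (V \ K) :=
        ⟨hx, hxV, connectedComponentIn_subset _ _ hx⟩
      rw [hcon] at this
      exact this
    have hclV : Disjoint (closure (connectedComponentIn Kᶜ z)) V := hCV.closure_left hV
    have hclosed : IsClosed (connectedComponentIn Kᶜ z) := by
      refine isClosed_of_closure_subset fun x hx => ?_
      have hsub : closure (connectedComponentIn Kᶜ z) ⊆ Kᶜ := fun w hw hwK =>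
        Set.disjoint_left.1 hclV hw (hKV hwK)
      exact (isPreconnected_connectedComponentIn.closure).subset_connectedComponentIn
        (subset_closure (mem_connectedComponentIn hz)) hsub hx
    have huniv := IsClopen.eq_univ ⟨hclosed, hCopen⟩ ⟨z, mem_connectedComponentIn hz⟩
    obtain ⟨k, hk⟩ := hne
    have : k ∈ connectedComponentIn Kᶜ z := huniv ▸ mem_univ k
    exact connectedComponentIn_subset _ _ this hk
  refine ⟨connectedComponentIn Kᶜ z ∪ (V \ K), ?_, Or.inr hy,
    Or.inl (mem_connectedComponentIn hz), ?_⟩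
  · exact union_subset (connectedComponentIn_subset _ _) fun x hx => hx.2
  · exact IsPreconnected.union' hmeet isPreconnected_connectedComponentIn hc.isPreconnected

theorem isConnected_annulus {ρ : ℝ} (hρ : 1 < ρ) :
    IsConnected (ball (0 : ℂ) ρ \ closedBall 0 1) := by
  have heq : ball (0 : ℂ) ρ \ closedBall 0 1 =
      (fun p : ℝ × ℝ => (p.1 : ℂ) * exp (p.2 * I)) '' (Ioo 1 ρ ×ˢ univ) := by
    ext z
    simp only [Set.mem_sdiff, mem_ball_zero_iff, mem_closedBall_zero_iff, not_le, mem_image, mem_prod,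
      mem_Ioo, mem_univ, and_true, Prod.exists]
    constructor
    · rintro ⟨h1, h2⟩
      exact ⟨‖z‖, z.arg, ⟨h2, h1⟩, norm_mul_exp_arg_mul_I z⟩
    · rintro ⟨a, b, ⟨h1, h2⟩, rfl⟩
      rw [norm_mul, norm_exp_ofReal_mul_I, mul_one, norm_real, Real.norm_of_nonneg (by linarith)]
      exact ⟨h2, h1⟩
  rw [heq]
  refine IsConnected.image ?_ _ (by fun_prop)
  exact (isConnected_Ioo hρ).prod isConnected_univ

/-- Rotating by an irrational angle and its inverse fills whole circles. -/
theorem exp_mul_mem_of_irrational {α : ℝ} (hα : Irrational α) {C : Set ℝ} (hC : IsClosed C)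
    (h0 : (0 : ℝ) ∈ C) (h1 : ∀ x ∈ C, x + α ∈ C) (h2 : ∀ x ∈ C, x - α ∈ C)
    (h3 : ∀ x ∈ C, ∀ n : ℤ, x + n ∈ C) : C = univ := by
  have hd : Dense (AddSubgroup.closure {α, (1 : ℝ)} : Set ℝ) := by
    rw [dense_addSubgroupClosure_pair_iff]; simpa using hα
  have hm : ∀ m : ℤ, (m : ℝ) * α ∈ C := by
    intro m
    induction m using Int.induction_on with
    | zero => simpa using h0
    | succ i ih => have := h1 _ ih; push_cast at this ⊢; convert this using 1; ring
    | pred i ih => have := h2 _ ih; push_cast at this ⊢; convert this using 1; ring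
  have hsub : (AddSubgroup.closure {α, (1 : ℝ)} : Set ℝ) ⊆ C := by
    intro x hx
    obtain ⟨m, n, rfl⟩ := AddSubgroup.mem_closure_pair.1 hx
    simpa using h3 _ (hm m) n
  exact eq_univ_of_univ_subset (hd.closure_eq ▸ closure_minimal hsub hC)

open Topology in
/-- An invariant continuum of a linearizable germ is a neighbourhood of the fixed point. -/
theorem mem_nhds_of_linearizable {α : ℝ} {f : ℂ → ℂ} {U K : Set ℂ} (hα : Irrational α)
    (hK : IsClosed K) (hKc : IsPreconnected K) (h0 : (0 : ℂ) ∈ K) {k : ℂ} (hk : k ∈ K)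
    (hk0 : k ≠ 0) (hU : IsOpen U) (hinj : InjOn f U) (hKU : K ⊆ U) (hf : f '' K = K)
    (hlin : Linearizable α f) : K ∈ 𝓝 (0 : ℂ) := by
  obtain ⟨h, V, hV, h0V, hd, hhinj, hh0, hconj⟩ := hlin
  have hcont : ContinuousAt h 0 := (hd.differentiableAt (hV.mem_nhds h0V)).continuousAt
  have hsmall : ∀ᶠ z in 𝓝 (0 : ℂ), h z ∈ U ∧ ‖h z‖ < ‖k‖ ∧ z ∈ V ∧
      f (h z) = h (exp (2 * Real.pi * I * α) * z) := by
    have e1 : ∀ᶠ z in 𝓝 (0 : ℂ), h z ∈ U :=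
      hcont.eventually_mem (hU.mem_nhds (by rw [hh0]; exact hKU h0))
    have e2 : ∀ᶠ z in 𝓝 (0 : ℂ), ‖h z‖ < ‖k‖ := by
      refine hcont.norm.eventually_lt_const ?_
      simpa [hh0] using hk0
    filter_upwards [e1, e2, hV.mem_nhds h0V, hconj] with z a b c d using ⟨a, b, c, d⟩
  obtain ⟨s, hs, hball⟩ := Metric.eventually_nhds_iff_ball.1 hsmall
  have hbV : ball (0 : ℂ) s ⊆ V := fun z hz => (hball z hz).2.2.1
  have hopen : ∀ t ≤ s, 0 < t → IsOpen (h '' ball 0 t) := by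
    intro t ht ht0
    have hsub : ball (0 : ℂ) t ⊆ V := (ball_subset_ball ht).trans hbV
    have han : AnalyticOnNhd ℂ h (ball 0 t) := (hd.mono hsub).analyticOnNhd isOpen_ball
    rcases han.is_constant_or_isOpen (convex_ball _ _).isPreconnected with ⟨w, hw⟩ | ho
    · exfalso
      have hz : ((t / 2 : ℝ) : ℂ) ∈ ball (0 : ℂ) t := by
        rw [mem_ball_zero_iff, norm_real, Real.norm_of_nonneg (by positivity)]; linarith
      have := hhinj (hsub hz) (hsub (mem_ball_self ht0))
        ((hw _ hz).trans (hw _ (mem_ball_self ht0)).symm)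
      rw [ofReal_eq_zero] at this
      linarith
    · exact ho _ Subset.rfl isOpen_ball
  have hsphere : ∀ z ∈ ball (0 : ℂ) s, h z ∈ K := by
    intro z hz
    rcases eq_or_ne z 0 with rfl | hz0
    · rwa [hh0]
    have hzs : ‖z‖ < s := by simpa using hz
    have hzpos : 0 < ‖z‖ := norm_pos_iff.2 hz0
    obtain ⟨ζ, hζ, hζK⟩ : ∃ ζ : ℂ, ‖ζ‖ = ‖z‖ ∧ h ζ ∈ K := by
      by_contra! hcon
      have hcc : IsClosed (h '' closedBall 0 ‖z‖) := by
        refine ((isCompact_closedBall _ _).image_of_continuousOn ?_).isClosed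
        exact hd.continuousOn.mono ((closedBall_subset_ball hzs).trans hbV)
      have hcover : K ⊆ h '' ball 0 ‖z‖ ∪ (h '' closedBall 0 ‖z‖)ᶜ := by
        intro x hx
        by_cases hx' : x ∈ h '' closedBall 0 ‖z‖
        · obtain ⟨w, hw, rfl⟩ := hx'
          left
          refine ⟨w, ?_, rfl⟩
          rw [mem_closedBall_zero_iff] at hw
          rw [mem_ball_zero_iff]
          exact lt_of_le_of_ne hw fun he => hcon w he hx
        · exact Or.inr hx'
      have hdis : Disjoint (h '' ball 0 ‖z‖) (h '' closedBall 0 ‖z‖)ᶜ :=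
        Set.disjoint_compl_right_iff_subset.2 (image_mono ball_subset_closedBall)
      rcases hKc.subset_or_subset (hopen _ hzs.le hzpos) hcc.isOpen_compl hdis hcover with hh | hh
      · obtain ⟨w, hw, hwk⟩ := hh hk
        have := (hball w (ball_subset_ball hzs.le hw)).2.1
        rw [hwk] at this
        exact lt_irrefl _ this
      · exact hh h0 ⟨0, by simp, hh0⟩
    have hrot : ∀ x : ℝ, exp (2 * Real.pi * I * x) * ζ ∈ ball (0 : ℂ) s := by
      intro x
      have : exp (2 * Real.pi * I * x) = exp ((2 * Real.pi * x : ℝ) * I) := by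
        congr 1; push_cast; ring
      rw [mem_ball_zero_iff, norm_mul, this, norm_exp_ofReal_mul_I, one_mul, hζ]
      exact hzs
    have hadd : ∀ x y : ℝ, exp (2 * Real.pi * I * (x + y : ℝ)) * ζ =
        exp (2 * Real.pi * I * y) * (exp (2 * Real.pi * I * x) * ζ) := by
      intro x y
      rw [← mul_assoc, ← Complex.exp_add]; congr 2; push_cast; ring
    have hC : {x : ℝ | h (exp (2 * Real.pi * I * x) * ζ) ∈ K} = univ := by
      refine exp_mul_mem_of_irrational hα ?_ ?_ ?_ ?_ ?_
      · refine hK.preimage ?_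
        refine (hd.continuousOn.mono hbV).comp_continuous (by fun_prop) hrot
      · simpa using hζK
      · intro x hx
        have hx' : h (exp (2 * Real.pi * I * x) * ζ) ∈ K := hx
        change h _ ∈ K
        rw [hadd, ← (hball _ (hrot x)).2.2.2, ← hf]
        exact mem_image_of_mem f hx'
      · intro x hx
        have hx' : h (exp (2 * Real.pi * I * x) * ζ) ∈ K := hx
        change h _ ∈ K
        rw [← hf] at hx'
        obtain ⟨w, hwK, hw⟩ := hx'
        have e := (hball _ (hrot (x - α))).2.2.2
        rw [← hadd, sub_add_cancel, ← hw] at e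
        have := hinj (hball _ (hrot (x - α))).1 (hKU hwK) e
        rw [this]; exact hwK
      · intro x hx n
        have hx' : h (exp (2 * Real.pi * I * x) * ζ) ∈ K := hx
        change h _ ∈ K
        have : exp (2 * Real.pi * I * (n : ℝ)) = 1 := by
          rw [Complex.exp_eq_one_iff]; exact ⟨n, by push_cast; ring⟩
        rw [hadd, this, one_mul]; exact hx'
    have hx : ((z / ζ).arg / (2 * Real.pi)) ∈ {x : ℝ | h (exp (2 * Real.pi * I * x) * ζ) ∈ K} :=
      hC ▸ mem_univ _
    have hζ0 : ζ ≠ 0 := norm_pos_iff.1 (hζ ▸ hzpos)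
    have hpi : (Real.pi : ℂ) ≠ 0 := ofReal_ne_zero.2 Real.pi_ne_zero
    have heq : exp (2 * Real.pi * I * ((z / ζ).arg / (2 * Real.pi) : ℝ)) * ζ = z := by
      have e1 : 2 * Real.pi * I * ((z / ζ).arg / (2 * Real.pi) : ℝ) = (z / ζ).arg * I := by
        push_cast; field_simp
      have e2 := norm_mul_exp_arg_mul_I (z / ζ)
      rw [norm_div, hζ, div_self hzpos.ne', ofReal_one, one_mul] at e2
      rw [e1, e2, div_mul_cancel₀ _ hζ0]
    have hx' : h (exp (2 * Real.pi * I * ((z / ζ).arg / (2 * Real.pi) : ℝ)) * ζ) ∈ K := hx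
    rwa [heq] at hx'
  refine mem_of_superset ((hopen s le_rfl hs).mem_nhds ⟨0, mem_ball_self hs, hh0⟩) ?_
  rintro _ ⟨z, hz, rfl⟩
  exact hsphere z hz

theorem exists_entire_primitive {g : ℂ → ℂ} (hg : Differentiable ℂ g) (y : ℂ) :
    ∃ G : ℂ → ℂ, G 0 = y ∧ ∀ z, HasDerivAt G (g z) z := by
  obtain ⟨G, hG, hG'⟩ := hg.isExactOn_univ.with_val_at 0 y
  exact ⟨G, hG, fun z => hG' z (mem_univ z)⟩

/-- A function with small logarithmic derivative and value `1` at the origin is close to `1`. -/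
theorem norm_sub_one_le_of_norm_deriv_le {F : ℂ → ℂ} (hF : DifferentiableOn ℂ F (ball 0 1))
    (h0 : F 0 = 1) {r τ : ℝ} (hr0 : 0 ≤ r) (hr : r < 1) (hτ0 : 0 ≤ τ) (hτ : τ ≤ 1 / 2)
    (hd : ∀ z ∈ closedBall (0 : ℂ) r, ‖deriv F z‖ ≤ τ * ‖F z‖) :
    ∀ z ∈ closedBall (0 : ℂ) r, ‖F z - 1‖ ≤ 2 * τ * ‖z‖ ∧ ‖F z‖ ≤ 2 := by
  have hsub : closedBall (0 : ℂ) r ⊆ ball 0 1 := closedBall_subset_ball hr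
  have hne : (closedBall (0 : ℂ) r).Nonempty := ⟨0, by simpa using hr0⟩
  obtain ⟨w, hw, hmax⟩ := (isCompact_closedBall (0 : ℂ) r).exists_isMaxOn hne
    (hF.continuousOn.mono hsub).norm
  have hmax' : ∀ z ∈ closedBall (0 : ℂ) r, ‖F z‖ ≤ ‖F w‖ := fun z hz => hmax hz
  have hmv : ∀ z ∈ closedBall (0 : ℂ) r, ‖F z - 1‖ ≤ τ * ‖F w‖ * ‖z‖ := by
    intro z hz
    have := (convex_closedBall (0 : ℂ) r).norm_image_sub_le_of_norm_deriv_le (f := F)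
      (C := τ * ‖F w‖) (x := 0) (y := z)
      (fun x hx => hF.differentiableAt (isOpen_ball.mem_nhds (hsub hx)))
      (fun x hx => (hd x hx).trans (mul_le_mul_of_nonneg_left (hmax' x hx) hτ0))
      (by simpa using hr0) hz
    simpa [h0] using this
  have hw2 : ‖F w‖ ≤ 2 := by
    have h1 := hmv w hw
    have h2 : ‖w‖ ≤ 1 := by rw [mem_closedBall_zero_iff] at hw; linarith
    have h3 : ‖F w‖ ≤ ‖F w - 1‖ + 1 := by
      have := norm_add_le (F w - 1) 1
      simpa using this
    have h4 : τ * ‖F w‖ * ‖w‖ ≤ 1 / 2 * ‖F w‖ := by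
      calc τ * ‖F w‖ * ‖w‖ ≤ τ * ‖F w‖ * 1 := by gcongr
        _ ≤ 1 / 2 * ‖F w‖ := by rw [mul_one]; gcongr
    linarith
  intro z hz
  refine ⟨(hmv z hz).trans ?_, (hmax' z hz).trans hw2⟩
  have : τ * ‖F w‖ ≤ 2 * τ := by nlinarith
  gcongr

/-- A holomorphic map close to the identity on a disk has a holomorphic inverse on a slightly
smaller disk. -/
theorem exists_inverse_of_deriv_near_one {F : ℂ → ℂ} (hF : DifferentiableOn ℂ F (ball 0 1))
    (h0 : F 0 = 0) {r κ : ℝ} (hr0 : 0 < r) (hr : r < 1) (hκ0 : 0 ≤ κ) (hκ : κ < 1)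
    (hd : ∀ z ∈ closedBall (0 : ℂ) r, ‖deriv F z - 1‖ ≤ κ) :
    ∃ J : ℂ → ℂ, DifferentiableOn ℂ J (ball 0 ((1 - κ) * r)) ∧
      (∀ y ∈ ball (0 : ℂ) ((1 - κ) * r), J y ∈ ball (0 : ℂ) r ∧ F (J y) = y) ∧
      (∀ x ∈ closedBall (0 : ℂ) r, F x ∈ ball (0 : ℂ) ((1 - κ) * r) → J (F x) = x) ∧
      ∀ x ∈ closedBall (0 : ℂ) r, ‖F x‖ ≤ (1 + κ) * ‖x‖ := by
  have hsub : closedBall (0 : ℂ) r ⊆ ball 0 1 := closedBall_subset_ball hr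
  have hda : ∀ x ∈ closedBall (0 : ℂ) r, DifferentiableAt ℂ F x := fun x hx =>
    hF.differentiableAt (isOpen_ball.mem_nhds (hsub hx))
  have hlip : ∀ x ∈ closedBall (0 : ℂ) r, ∀ y ∈ closedBall (0 : ℂ) r,
      ‖F x - F y - (x - y)‖ ≤ κ * ‖x - y‖ := by
    intro x hx y hy
    have := (convex_closedBall (0 : ℂ) r).norm_image_sub_le_of_norm_hasDerivWithin_le
      (f := fun z => F z - z) (f' := fun z => deriv F z - 1) (C := κ) (x := y) (y := x)
      (fun z hz => ((hda z hz).hasDerivAt.sub (hasDerivAt_id z)).hasDerivWithinAt) hd hy hx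
    have e : F x - F y - (x - y) = (F x - x) - (F y - y) := by ring
    rw [e]
    exact this
  have hanti : ∀ x ∈ closedBall (0 : ℂ) r, ∀ y ∈ closedBall (0 : ℂ) r,
      (1 - κ) * ‖x - y‖ ≤ ‖F x - F y‖ := by
    intro x hx y hy
    have h1 := hlip x hx y hy
    have h2 := norm_sub_norm_le (x - y) (F x - F y)
    rw [norm_sub_rev (x - y)] at h2
    linarith
  have hmem0 : (0 : ℂ) ∈ closedBall (0 : ℂ) r := by simpa using hr0.le
  have hsurj : ∀ y ∈ ball (0 : ℂ) ((1 - κ) * r), ∃ x ∈ ball (0 : ℂ) r, F x = y := by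
    intro y hy
    have happ : ApproximatesLinearOn F (ContinuousLinearEquiv.refl ℂ ℂ : ℂ →L[ℂ] ℂ)
        (closedBall 0 r) ⟨κ, hκ0⟩ := by
      intro x hx y hy
      exact hlip x hx y hy
    have hs := happ.surjOn_closedBall_of_nonlinearRightInverse
      (ContinuousLinearEquiv.refl ℂ ℂ).toNonlinearRightInverse (b := 0) (ε := r) hr0.le Subset.rfl
    have hn : ((ContinuousLinearEquiv.refl ℂ ℂ).toNonlinearRightInverse.nnnorm : ℝ) ≤ 1 := by
      change ‖(ContinuousLinearMap.id ℂ ℂ)‖ ≤ 1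
      exact ContinuousLinearMap.norm_id_le
    have hn0 : 0 < ((ContinuousLinearEquiv.refl ℂ ℂ).toNonlinearRightInverse.nnnorm : ℝ) := by
      change 0 < ‖(ContinuousLinearMap.id ℂ ℂ)‖
      rw [ContinuousLinearMap.norm_id]; exact one_pos
    have hy' : y ∈ closedBall (F 0)
        ((((ContinuousLinearEquiv.refl ℂ ℂ).toNonlinearRightInverse.nnnorm : ℝ)⁻¹ -
          (⟨κ, hκ0⟩ : NNReal)) * r) := by
      rw [h0, mem_closedBall_zero_iff]
      rw [mem_ball_zero_iff] at hy
      have : 1 ≤ ((ContinuousLinearEquiv.refl ℂ ℂ).toNonlinearRightInverse.nnnorm : ℝ)⁻¹ :=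
        (one_le_inv₀ hn0).2 hn
      refine hy.le.trans ?_
      change (1 - κ) * r ≤ (_ - κ) * r
      gcongr
    obtain ⟨x, hx, rfl⟩ := hs hy'
    refine ⟨x, ?_, rfl⟩
    have h1 := hanti x hx 0 hmem0
    rw [sub_zero, h0, sub_zero] at h1
    rw [mem_ball_zero_iff] at hy ⊢
    have := lt_of_le_of_lt h1 hy
    exact lt_of_mul_lt_mul_left this (by linarith)
  choose! J hJ using hsurj
  have hκ' : 0 < 1 - κ := by linarith
  have hJF : ∀ x ∈ closedBall (0 : ℂ) r, F x ∈ ball (0 : ℂ) ((1 - κ) * r) → J (F x) = x := by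
    intro x hx hFx
    have h1 := hanti (J (F x)) (ball_subset_closedBall (hJ _ hFx).1) x hx
    rw [(hJ _ hFx).2, sub_self, norm_zero] at h1
    have : ‖J (F x) - x‖ ≤ 0 := by
      by_contra! hc
      have := mul_pos hκ' hc
      linarith
    exact sub_eq_zero.1 (norm_le_zero_iff.1 this)
  refine ⟨J, ?_, hJ, hJF, ?_⟩
  · intro y hy
    have hcont : ContinuousAt J y := by
      rw [Metric.continuousAt_iff]
      intro ε hε
      have hnb := isOpen_ball.mem_nhds hy
      obtain ⟨η, hη, hηb⟩ := Metric.mem_nhds_iff.1 hnb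
      refine ⟨min η ((1 - κ) * ε), by positivity, fun {x} hx => ?_⟩
      have hx1 := hJ x (hηb (lt_of_lt_of_le hx (min_le_left _ _)))
      have hy1 := hJ y hy
      have h1 := hanti _ (ball_subset_closedBall hx1.1) _ (ball_subset_closedBall hy1.1)
      rw [hx1.2, hy1.2, ← dist_eq_norm, ← dist_eq_norm] at h1
      exact lt_of_mul_lt_mul_left
        (lt_of_le_of_lt h1 (lt_of_lt_of_le hx (min_le_right _ _))) hκ'.le
    have hne : deriv F (J y) ≠ 0 := by
      intro hz
      have := hd (J y) (ball_subset_closedBall (hJ y hy).1)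
      rw [hz] at this
      norm_num at this
      linarith
    have := HasDerivAt.of_local_left_inverse hcont
      (hda _ (ball_subset_closedBall (hJ y hy).1)).hasDerivAt hne
      (by filter_upwards [isOpen_ball.mem_nhds hy] with x hx using (hJ x hx).2)
    exact this.differentiableAt.differentiableWithinAt
  · intro x hx
    have h1 := hlip x hx 0 hmem0
    rw [h0, sub_zero, sub_zero] at h1
    have := norm_add_le (F x - x) x
    rw [sub_add_cancel] at this
    linarith

/-- A nowhere critical entire function is uniformly expanding at a small scale. -/
theorem exists_uniform_expansion {ψ : ℂ → ℂ} (hψ : Differentiable ℂ ψ)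
    (hψ' : ∀ z, deriv ψ z ≠ 0) {R : ℝ} (hR : 0 < R) {δ : ℝ} (hδ : 0 < δ) :
    ∃ s m : ℝ, 0 < s ∧ s ≤ δ ∧ 0 < m ∧ ∀ z ∈ closedBall (0 : ℂ) R, ∀ x ∈ closedBall z s,
      ∀ y ∈ closedBall z s, m * ‖x - y‖ ≤ ‖ψ x - ψ y‖ := by
  have hcont : Continuous (deriv ψ) := hψ.contDiff.continuous_deriv (n := 1) le_rfl
  obtain ⟨w, -, hmin⟩ := (isCompact_closedBall (0 : ℂ) R).exists_isMinOn
    ⟨0, by simpa using hR.le⟩ hcont.norm.continuousOn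
  have hw : 0 < ‖deriv ψ w‖ := norm_pos_iff.2 (hψ' w)
  have huc := (isCompact_closedBall (0 : ℂ) (R + 1)).uniformContinuousOn_of_continuous
    hcont.continuousOn
  obtain ⟨η, hη, huc⟩ := Metric.uniformContinuousOn_iff.1 huc (‖deriv ψ w‖ / 2) (by positivity)
  refine ⟨min δ (min (η / 2) 1), ‖deriv ψ w‖ / 2, by positivity, min_le_left _ _, by positivity, ?_⟩
  intro z hz x hx y hy
  have hs1 : min δ (min (η / 2) 1) ≤ 1 := (min_le_right _ _).trans (min_le_right _ _)
  have hs2 : min δ (min (η / 2) 1) ≤ η / 2 := (min_le_right _ _).trans (min_le_left _ _)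
  have hz' : ‖z‖ ≤ R := by simpa using hz
  have hmv := (convex_closedBall z (min δ (min (η / 2) 1))).norm_image_sub_le_of_norm_hasDerivWithin_le
    (f := fun u => ψ u - deriv ψ z * u) (f' := fun u => deriv ψ u - deriv ψ z)
    (C := ‖deriv ψ w‖ / 2) (x := y) (y := x)
    (fun u _ => by
      have := ((hψ u).hasDerivAt.fun_sub
        ((hasDerivAt_id' u).const_mul (deriv ψ z))).hasDerivWithinAt
          (s := closedBall z (min δ (min (η / 2) 1)))
      rwa [mul_one] at this)
    (fun u hu => by
      have hu' : dist u z ≤ min δ (min (η / 2) 1) := hu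
      have huR : u ∈ closedBall (0 : ℂ) (R + 1) := by
        rw [mem_closedBall_zero_iff]
        have := norm_add_le (u - z) z
        rw [sub_add_cancel, ← dist_eq_norm] at this
        linarith
      have := huc u huR z (by rw [mem_closedBall_zero_iff]; linarith) (by linarith)
      rw [dist_eq_norm] at this
      exact this.le) hy hx
  have hz2 : ‖deriv ψ w‖ ≤ ‖deriv ψ z‖ := hmin hz
  have h1 : ‖deriv ψ z‖ * ‖x - y‖ ≤ ‖ψ x - ψ y‖ + ‖deriv ψ w‖ / 2 * ‖x - y‖ := by
    rw [← norm_mul]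
    have e : deriv ψ z * (x - y) =
        (ψ x - ψ y) - ((ψ x - deriv ψ z * x) - (ψ y - deriv ψ z * y)) := by ring
    rw [e]
    exact (norm_sub_le _ _).trans (by gcongr)
  have h2 : ‖deriv ψ w‖ * ‖x - y‖ ≤ ‖deriv ψ z‖ * ‖x - y‖ := by gcongr
  linarith

open Topology in
/-- The rotations of the disk parametrised by `φ` extend, for small angles, to holomorphic
near-identity maps of a given ball, by lifting rotations through the local homeomorphism `ψ`. -/
theorem exists_lift_rotation {ψ φ : ℂ → ℂ} (hψ : Differentiable ℂ ψ)
    (hψ' : ∀ z, deriv ψ z ≠ 0) {ρ : ℝ} (hρ : 1 < ρ) (hφ : DifferentiableOn ℂ φ (ball 0 ρ))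
    (hψφ : ∀ ζ ∈ ball (0 : ℂ) ρ, ψ (φ ζ) = ζ) {R : ℝ} (hR : 0 < R)
    (hφR : ∀ ζ ∈ closedBall (0 : ℂ) 1, φ ζ ∈ ball (0 : ℂ) R) {δ : ℝ} (hδ : 0 < δ) :
    ∃ ε₀ > 0, ∀ ε : ℝ, 0 < ε → ε < ε₀ → ∃ g : ℂ → ℂ, DifferentiableOn ℂ g (ball 0 R) ∧
      (∀ z ∈ ball (0 : ℂ) R, ‖g z - z‖ ≤ δ) ∧
      ∀ ζ ∈ closedBall (0 : ℂ) 1, g (φ ζ) = φ (exp (2 * Real.pi * I * ε) * ζ) := by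
  obtain ⟨s, m, hs, hsδ, hm, hexp⟩ := exists_uniform_expansion hψ hψ' hR hδ
  obtain ⟨B, hB⟩ := (isCompact_closedBall (0 : ℂ) R).exists_bound_of_continuousOn
    hψ.continuous.continuousOn
  have hB0 : 0 ≤ B := (norm_nonneg _).trans (hB 0 (by simpa using hR.le))
  have huc := (isCompact_closedBall (0 : ℂ) 1).uniformContinuousOn_of_continuous
    (hφ.continuousOn.mono (closedBall_subset_ball hρ))
  obtain ⟨η, hη, huc⟩ := Metric.uniformContinuousOn_iff.1 huc s hs
  have hlim : Tendsto (fun ε : ℝ => ‖exp (2 * Real.pi * I * ε) - 1‖) (𝓝 0) (𝓝 0) := by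
    have : Continuous fun ε : ℝ => ‖exp (2 * Real.pi * I * ε) - 1‖ := by fun_prop
    simpa using this.tendsto 0
  have hpos : 0 < min η (m * (s / 2) / 2 / (B + 1)) := by positivity
  obtain ⟨ε₀, hε₀, hsmall⟩ := Metric.eventually_nhds_iff_ball.1 (hlim.eventually_lt_const hpos)
  refine ⟨ε₀, hε₀, fun ε hε0 hεlt => ?_⟩
  have he := hsmall ε (by rw [mem_ball_zero_iff, Real.norm_of_nonneg hε0.le]; exact hεlt)
  set e : ℂ := exp (2 * Real.pi * I * ε) with he_def
  have hnorm : ‖e‖ = 1 := by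
    have : e = exp ((2 * Real.pi * ε : ℝ) * I) := by
      rw [he_def]; congr 1; push_cast; ring
    rw [this, norm_exp_ofReal_mul_I]
  have he1 : ‖e - 1‖ < η := he.trans_le (min_le_left _ _)
  have he2 : ‖e - 1‖ * (B + 1) < m * (s / 2) / 2 := by
    have := he.trans_le (min_le_right _ _)
    rwa [lt_div_iff₀ (by positivity)] at this
  have hsol : ∀ z ∈ ball (0 : ℂ) R, ∃ w ∈ closedBall z (s / 2), ψ w = e * ψ z := by
    intro z hz
    have hzc := ball_subset_closedBall hz
    have hcov := DiffContOnCl.ball_subset_image_closedBall (f := ψ) (z₀ := z) (r := s / 2)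
      (ε := m * (s / 2)) hψ.diffContOnCl (by positivity)
      (fun x hx => by
        have hx' : dist x z = s / 2 := hx
        have := hexp z hzc x (by rw [mem_closedBall, hx']; linarith) z
          (mem_closedBall_self hs.le)
        rwa [← dist_eq_norm x z, hx'] at this)
      (by
        have : ∀ᶠ x in 𝓝[≠] z, ψ x ≠ ψ z := by
          filter_upwards [self_mem_nhdsWithin,
            mem_nhdsWithin_of_mem_nhds (closedBall_mem_nhds z hs)] with x hx hx'
          intro hxe
          have h1 := hexp z hzc x hx' z (mem_closedBall_self hs.le)
          rw [hxe, sub_self, norm_zero] at h1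
          have : 0 < ‖x - z‖ := norm_pos_iff.2 (sub_ne_zero.2 hx)
          have := mul_pos hm this
          linarith
        exact this.frequently.filter_mono nhdsWithin_le_nhds)
    have hmem : e * ψ z ∈ ball (ψ z) (m * (s / 2) / 2) := by
      rw [mem_ball, dist_eq_norm]
      have : e * ψ z - ψ z = (e - 1) * ψ z := by ring
      rw [this, norm_mul]
      refine lt_of_le_of_lt ?_ he2
      gcongr
      linarith [hB z hzc]
    obtain ⟨w, hw, hw'⟩ := hcov hmem
    exact ⟨w, hw, hw'⟩
  choose! g hg using hsol
  have huniq : ∀ z ∈ ball (0 : ℂ) R, ∀ w ∈ closedBall z s, ψ w = e * ψ z → g z = w := by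
    intro z hz w hw hww
    have h1 := hexp z (ball_subset_closedBall hz) (g z)
      (closedBall_subset_closedBall (by linarith) (hg z hz).1) w hw
    rw [(hg z hz).2, hww, sub_self, norm_zero] at h1
    have : ‖g z - w‖ ≤ 0 := by
      by_contra! hc
      have := mul_pos hm hc
      linarith
    exact sub_eq_zero.1 (norm_le_zero_iff.1 this)
  have hgcont : ∀ z₀ ∈ ball (0 : ℂ) R, ContinuousAt g z₀ := by
    intro z₀ hz₀
    rw [Metric.continuousAt_iff]
    intro ε' hε'
    have hc : ContinuousAt ψ z₀ := hψ.continuous.continuousAt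
    obtain ⟨η₁, hη₁, hc⟩ := Metric.continuousAt_iff.1 hc (m * ε') (by positivity)
    obtain ⟨η₂, hη₂, hb⟩ := Metric.mem_nhds_iff.1 (isOpen_ball.mem_nhds hz₀)
    refine ⟨min η₁ (min η₂ (s / 2)), by positivity, fun {z} hz => ?_⟩
    have hz1 : dist z z₀ < η₁ := hz.trans_le (min_le_left _ _)
    have hz2 : z ∈ ball (0 : ℂ) R :=
      hb (hz.trans_le ((min_le_right _ _).trans (min_le_left _ _)))
    have hz3 : dist z z₀ < s / 2 := hz.trans_le ((min_le_right _ _).trans (min_le_right _ _))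
    have h1 : g z ∈ closedBall z₀ s := by
      have h2 : dist (g z) z ≤ s / 2 := (hg z hz2).1
      have := dist_triangle (g z) z z₀
      rw [mem_closedBall]; linarith
    have h2 : g z₀ ∈ closedBall z₀ s := closedBall_subset_closedBall (by linarith) (hg z₀ hz₀).1
    have h3 := hexp z₀ (ball_subset_closedBall hz₀) _ h1 _ h2
    rw [(hg z hz2).2, (hg z₀ hz₀).2, ← mul_sub, norm_mul, hnorm, one_mul, ← dist_eq_norm,
      ← dist_eq_norm] at h3
    exact lt_of_mul_lt_mul_left (h3.trans_lt (hc hz1)) hm.le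
  refine ⟨g, fun z hz => ?_, fun z hz => ?_, fun ζ hζ => ?_⟩
  · have hstrict : HasStrictDerivAt ψ (deriv ψ (g z)) (g z) :=
      (hψ.analyticAt (g z)).hasStrictDerivAt
    set inv := hstrict.localInverse _ _ _ (hψ' _) with hinv
    have hli : ∀ᶠ w in 𝓝 (g z), inv (ψ w) = w :=
      (hstrict.hasStrictFDerivAt_equiv (hψ' _)).eventually_left_inverse
    have hdi : DifferentiableAt ℂ inv (e * ψ z) := by
      rw [← (hg z hz).2]
      exact (hstrict.to_localInverse (hψ' _)).hasDerivAt.differentiableAt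
    have heq : g =ᶠ[𝓝 z] fun x => inv (e * ψ x) := by
      filter_upwards [(hgcont z hz).eventually hli, isOpen_ball.mem_nhds hz] with x hx hxR
      rw [← (hg x hxR).2, hx]
    have : DifferentiableAt ℂ (fun x => inv (e * ψ x)) z :=
      DifferentiableAt.comp z hdi ((hψ z).const_mul e)
    exact (this.congr_of_eventuallyEq heq).differentiableWithinAt
  · have : dist (g z) z ≤ s / 2 := (hg z hz).1
    rw [← dist_eq_norm]; linarith
  · have heζ : e * ζ ∈ closedBall (0 : ℂ) 1 := by
      rw [mem_closedBall_zero_iff] at hζ ⊢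
      rw [norm_mul, hnorm, one_mul]; exact hζ
    refine huniq _ (hφR ζ hζ) _ ?_ ?_
    · refine (huc _ heζ _ hζ ?_).le
      rw [dist_eq_norm]
      have : e * ζ - ζ = (e - 1) * ζ := by ring
      rw [this, norm_mul]
      rw [mem_closedBall_zero_iff] at hζ
      calc ‖e - 1‖ * ‖ζ‖ ≤ ‖e - 1‖ * 1 := by gcongr
        _ < η := by rw [mul_one]; exact he1
    · rw [hψφ _ (closedBall_subset_ball hρ heζ), hψφ _ (closedBall_subset_ball hρ hζ)]

theorem re_one_add_div_one_sub_pos {z : ℂ} (hz : ‖z‖ < 1) : 0 < ((1 + z) / (1 - z)).re := by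
  have h1 : (1 - z) ≠ 0 := by
    intro h
    rw [← sub_eq_zero.1 h] at hz
    simp at hz
  have h2 : 0 < normSq (1 - z) := normSq_pos.2 h1
  have h3 : normSq z < 1 := by
    rw [normSq_eq_norm_sq]; nlinarith [norm_nonneg z]
  rw [normSq_apply] at h3
  rw [div_re, ← add_div]
  refine div_pos ?_ h2
  simp
  nlinarith

theorem norm_sub_one_div_add_one_lt {N : ℂ} (hN : 0 < N.re) : ‖(N - 1) / (N + 1)‖ < 1 := by
  have h1 : N + 1 ≠ 0 := by
    intro h
    have := congrArg re h
    simp at this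
    linarith
  rw [norm_div, div_lt_one (norm_pos_iff.2 h1), ← sq_lt_sq₀ (norm_nonneg _) (norm_nonneg _),
    ← normSq_eq_norm_sq, ← normSq_eq_norm_sq, normSq_apply, normSq_apply]
  simp
  nlinarith

/-- The principal square root on the slit plane, written through the logarithm. -/
def slitSqrt (z : ℂ) : ℂ := exp (log z / 2)

theorem slitSqrt_sq {z : ℂ} (hz : z ≠ 0) : slitSqrt z ^ 2 = z := by
  rw [slitSqrt, ← Complex.exp_nat_mul]
  push_cast
  rw [mul_div_cancel₀ _ two_ne_zero, exp_log hz]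

theorem slitSqrt_re_pos {z : ℂ} (hz : z ∈ slitPlane) : 0 < (slitSqrt z).re := by
  rw [slitSqrt, exp_re]
  refine mul_pos (Real.exp_pos _) (Real.cos_pos_of_mem_Ioo ?_)
  have h1 : (log z / 2).im = z.arg / 2 := by
    rw [← ofReal_ofNat, div_ofReal_im, log_im]
  have h2 := neg_pi_lt_arg z
  have h3 := (arg_le_pi z).lt_of_ne (mem_slitPlane_iff_arg.1 hz).1
  rw [h1]
  constructor <;> linarith

theorem slitSqrt_eq_of_sq {N z : ℂ} (hN : 0 < N.re) (hz : z ∈ slitPlane) (h : N ^ 2 = z) :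
    slitSqrt z = N := by
  have h1 := slitSqrt_sq (slitPlane_ne_zero hz)
  rw [← h] at h1
  rcases sq_eq_sq_iff_eq_or_eq_neg.1 h1 with h2 | h2
  · rw [← h, h2]
  · have h3 := slitSqrt_re_pos hz
    rw [← h, h2, neg_re] at h3
    linarith

theorem hasDerivAt_slitSqrt {z : ℂ} (hz : z ∈ slitPlane) :
    HasDerivAt slitSqrt (1 / (2 * slitSqrt z)) z := by
  have h := ((hasDerivAt_log hz).div_const 2).cexp
  have h2 : slitSqrt z ^ 2 = z := slitSqrt_sq (slitPlane_ne_zero hz)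
  have h3 : slitSqrt z ≠ 0 := exp_ne_zero _
  refine HasDerivAt.congr_deriv (f := slitSqrt) h ?_
  change slitSqrt z * (z⁻¹ / 2) = 1 / (2 * slitSqrt z)
  have h4 : z⁻¹ = (slitSqrt z ^ 2)⁻¹ := by rw [h2]
  rw [h4]
  field_simp

theorem mem_slitPlane_of_sq {M : ℂ} (hM : 0 < M.re) {c d : ℝ} (hc : 0 < c) (hd : 0 ≤ d) :
    (c : ℂ) * M ^ 2 + d ∈ slitPlane := by
  rw [mem_slitPlane_iff]
  by_cases h : M.im = 0
  · left
    simp [pow_two, h]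
    positivity
  · right
    have : (M ^ 2).im = 2 * (M.re * M.im) := by rw [pow_two, mul_im]; ring
    rw [add_im, ofReal_im, add_zero, im_ofReal_mul, this]
    have := mul_ne_zero hM.ne' h
    positivity

/-- The Riemann map of the disk slit along a negative radial segment, together with the
identities satisfied by its derivative. -/
theorem exists_slit_map {b : ℝ} (hb0 : 0 < b) (hb1 : b < 1) :
    ∃ χ v L : ℂ → ℂ, DifferentiableOn ℂ χ (ball 0 1) ∧ DifferentiableOn ℂ v (ball 0 1) ∧
      DifferentiableOn ℂ L (ball 0 1) ∧ (∀ z ∈ ball (0 : ℂ) 1, χ z ∈ ball (0 : ℂ) 1) ∧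
      (∀ z ∈ ball (0 : ℂ) 1, χ z = z * v z) ∧ (∀ z ∈ ball (0 : ℂ) 1, v z ≠ 0) ∧
      (∀ z ∈ ball (0 : ℂ) 1, deriv χ z = v z * L z) ∧ L 0 = 1 ∧
      (∀ z ∈ ball (0 : ℂ) 1, deriv L z = L z * (deriv χ z *
        (2 * b ^ 2 / (1 - b ^ 2) * (1 - χ z) / ((χ z + (1 : ℝ)) * (χ z + ((1 - b) / (1 + b) : ℝ)) *
          (χ z + ((1 + b) / (1 - b) : ℝ)))))) ∧
      (∀ z ∈ ball (0 : ℂ) 1, ∀ t : ℝ, (1 - b) / (1 + b) ≤ t → χ z + t ≠ 0) ∧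
      (∀ w ∈ ball (0 : ℂ) 1, w.im ≠ 0 → ∃ z ∈ ball (0 : ℂ) 1, χ z = w) := by
  have hbb : 0 < 1 - b ^ 2 := by nlinarith
  have hbbC : (1 - (b : ℂ) ^ 2) ≠ 0 := by
    have := ofReal_ne_zero.2 hbb.ne'
    push_cast at this; exact this
  set M : ℂ → ℂ := fun z => (1 + z) / (1 - z) with hM
  set P : ℂ → ℂ := fun z => (1 - b ^ 2 : ℝ) * M z ^ 2 + (b ^ 2 : ℝ) with hP
  set N : ℂ → ℂ := fun z => slitSqrt (P z) with hN
  have h1z : ∀ z ∈ ball (0 : ℂ) 1, 1 - z ≠ 0 := by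
    intro z hz h
    rw [mem_ball_zero_iff, ← sub_eq_zero.1 h] at hz
    simp at hz
  have hMre : ∀ z ∈ ball (0 : ℂ) 1, 0 < (M z).re := fun z hz =>
    re_one_add_div_one_sub_pos (by simpa using hz)
  have hPs : ∀ z ∈ ball (0 : ℂ) 1, P z ∈ slitPlane := fun z hz =>
    mem_slitPlane_of_sq (hMre z hz) hbb (by positivity)
  have hNre : ∀ z ∈ ball (0 : ℂ) 1, 0 < (N z).re := fun z hz => slitSqrt_re_pos (hPs z hz)
  have hNsq : ∀ z ∈ ball (0 : ℂ) 1, N z ^ 2 = (1 - b ^ 2) * M z ^ 2 + b ^ 2 := fun z hz => by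
    have := slitSqrt_sq (slitPlane_ne_zero (hPs z hz))
    rw [hN]; simp only []; rw [this, hP]; push_cast; rfl
  have hne : ∀ u : ℂ, 0 < u.re → u ≠ 0 ∧ u + 1 ≠ 0 := by
    intro u hu
    constructor <;> intro h <;> have := congrArg re h <;> simp at this <;> linarith
  have hM0 : ∀ z ∈ ball (0 : ℂ) 1, M z ≠ 0 ∧ M z + 1 ≠ 0 := fun z hz => hne _ (hMre z hz)
  have hN0 : ∀ z ∈ ball (0 : ℂ) 1, N z ≠ 0 ∧ N z + 1 ≠ 0 := fun z hz => hne _ (hNre z hz)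
  have hzM : ∀ z ∈ ball (0 : ℂ) 1, z * (M z + 1) = M z - 1 := by
    intro z hz
    have := h1z z hz
    simp only [hM]; field_simp; ring
  have hMd : ∀ z ∈ ball (0 : ℂ) 1, HasDerivAt M ((M z + 1) ^ 2 / 2) z := by
    intro z hz
    have h1 := h1z z hz
    have := ((hasDerivAt_id' z).const_add 1).fun_div ((hasDerivAt_id' z).const_sub 1) h1
    refine this.congr_deriv ?_
    simp only [hM]; field_simp; ring
  have hNd : ∀ z ∈ ball (0 : ℂ) 1,
      HasDerivAt N ((1 - b ^ 2) * M z * (M z + 1) ^ 2 / (2 * N z)) z := by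
    intro z hz
    have hPd : HasDerivAt P ((1 - b ^ 2 : ℝ) * (2 * M z * ((M z + 1) ^ 2 / 2))) z := by
      have := (((hMd z hz).fun_pow 2).const_mul (((1 - b ^ 2 : ℝ)) : ℂ)).add_const
        (((b ^ 2 : ℝ)) : ℂ)
      refine this.congr_deriv ?_
      simp
    have := (hasDerivAt_slitSqrt (hPs z hz)).comp z hPd
    refine this.congr_deriv ?_
    change 1 / (2 * N z) * _ = _
    have := (hN0 z hz).1
    push_cast
    field_simp
  have hχd : ∀ z ∈ ball (0 : ℂ) 1, HasDerivAt (fun z => (N z - 1) / (N z + 1))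
      ((1 - b ^ 2) * (M z + 1) ^ 2 / (N z + 1) ^ 2 * (M z / N z)) z := by
    intro z hz
    obtain ⟨h1, h2⟩ := hN0 z hz
    have := ((hNd z hz).sub_const 1).fun_div ((hNd z hz).add_const 1) h2
    refine this.congr_deriv ?_
    field_simp
    ring
  have hLd : ∀ z ∈ ball (0 : ℂ) 1, HasDerivAt (fun z => M z / N z)
      (((M z + 1) ^ 2 / 2 * N z - M z * ((1 - b ^ 2) * M z * (M z + 1) ^ 2 / (2 * N z)))
        / N z ^ 2) z := fun z hz => (hMd z hz).fun_div (hNd z hz) (hN0 z hz).1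
  have havoid : ∀ z ∈ ball (0 : ℂ) 1, ∀ t : ℝ, (1 - b) / (1 + b) ≤ t →
      (N z - 1) / (N z + 1) + t ≠ 0 := by
    intro z hz t ht h
    obtain ⟨h1, h2⟩ := hN0 z hz
    have hb1' : (0 : ℝ) < 1 + b := by linarith
    have ht0 : 0 < t := lt_of_lt_of_le (div_pos (by linarith) hb1') ht
    have e : N z * (1 + t) = 1 - t := by
      field_simp at h; linear_combination h
    have ere := congrArg re e
    have eim := congrArg im e
    have e1 : ((1 : ℂ) + t) = ((1 + t : ℝ) : ℂ) := by push_cast; rfl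
    have e2 : ((1 : ℂ) - t) = ((1 - t : ℝ) : ℂ) := by push_cast; rfl
    rw [e1, e2, re_mul_ofReal, ofReal_re] at ere
    rw [e1, e2, im_mul_ofReal, ofReal_im] at eim
    have him : (N z).im = 0 := (mul_eq_zero.1 eim).resolve_right (by linarith)
    have hNr := hNre z hz
    have hle : (N z).re ≤ b := by
      rw [div_le_iff₀ hb1'] at ht
      by_contra! hc
      nlinarith
    have hsq := hNsq z hz
    have q1 := congrArg re hsq
    have q2 := congrArg im hsq
    have hc : (1 - (b : ℂ) ^ 2) = ((1 - b ^ 2 : ℝ) : ℂ) := by push_cast; rfl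
    have hc2 : ((b : ℂ) ^ 2) = ((b ^ 2 : ℝ) : ℂ) := by push_cast; rfl
    rw [hc, hc2, add_re, re_ofReal_mul, ofReal_re, pow_two (N z), pow_two (M z), mul_re,
      mul_re, him] at q1
    rw [hc, hc2, add_im, im_ofReal_mul, ofReal_im, pow_two (N z), pow_two (M z), mul_im,
      mul_im, him] at q2
    have hMr := hMre z hz
    have hMi : (M z).im = 0 := by
      have : (1 - b ^ 2) * (2 * (M z).re) * (M z).im = 0 := by linear_combination -q2
      exact (mul_eq_zero.1 this).resolve_left (by positivity)
    rw [hMi] at q1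
    have : 0 < (1 - b ^ 2) * ((M z).re * (M z).re) := by positivity
    nlinarith
  have hM00 : M 0 = 1 := by simp [hM]
  have hN00 : N 0 = 1 := by
    refine slitSqrt_eq_of_sq (by simp) (hPs 0 (by simp)) ?_
    simp [hP, hM00]
  have hNid : ∀ z ∈ ball (0 : ℂ) 1, (N z - 1) / (N z + 1) =
      z * ((1 - b ^ 2) * (M z + 1) ^ 2 / (N z + 1) ^ 2) := by
    intro z hz
    obtain ⟨h1, h2⟩ := hN0 z hz
    have h3 := hNsq z hz
    have h4 := hzM z hz
    field_simp
    linear_combination h3 - (1 - (b : ℂ) ^ 2) * (M z + 1) * h4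
  refine ⟨fun z => (N z - 1) / (N z + 1), fun z => (1 - b ^ 2) * (M z + 1) ^ 2 / (N z + 1) ^ 2,
    fun z => M z / N z, fun z hz => (hχd z hz).differentiableAt.differentiableWithinAt, ?_,
    fun z hz => (hLd z hz).differentiableAt.differentiableWithinAt,
    fun z hz => by simpa using norm_sub_one_div_add_one_lt (hNre z hz), hNid, ?_,
    fun z hz => (hχd z hz).deriv, by simp [hM00, hN00], ?_, havoid, ?_⟩
  · intro z hz
    refine DifferentiableAt.differentiableWithinAt ?_
    exact ((((hMd z hz).differentiableAt.add_const 1).fun_pow 2).const_mul _).fun_div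
      (((hNd z hz).differentiableAt.add_const 1).fun_pow 2) (pow_ne_zero 2 (hN0 z hz).2)
  · intro z hz
    exact div_ne_zero (mul_ne_zero hbbC (pow_ne_zero 2 (hM0 z hz).2)) (pow_ne_zero 2 (hN0 z hz).2)
  · intro z hz
    rw [(hLd z hz).deriv, (hχd z hz).deriv]
    obtain ⟨h1, h2⟩ := hN0 z hz
    obtain ⟨h5, h6⟩ := hM0 z hz
    have h3 := hNsq z hz
    have hs1 : (1 - b) / (1 + b) ≤ 1 := by rw [div_le_one (by linarith)]; linarith
    have hs2 : (1 - b) / (1 + b) ≤ (1 + b) / (1 - b) := by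
      rw [div_le_div_iff₀ (by linarith) (by linarith)]; nlinarith
    have a1 := havoid z hz 1 hs1
    have a2 := havoid z hz _ le_rfl
    have a3 := havoid z hz _ hs2
    have hb1C : (1 : ℂ) + b ≠ 0 := by
      have : (1 + b : ℝ) ≠ 0 := by linarith
      have := ofReal_ne_zero.2 this; push_cast at this; exact this
    have hb2C : (1 : ℂ) - b ≠ 0 := by
      have : (1 - b : ℝ) ≠ 0 := by linarith
      have := ofReal_ne_zero.2 this; push_cast at this; exact this
    have k1 : (N z - 1) / (N z + 1) + (1 : ℝ) = 2 * N z / (N z + 1) := by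
      push_cast; field_simp; ring
    have k2 : (N z - 1) / (N z + 1) + ((1 - b) / (1 + b) : ℝ) =
        2 * (N z - b) / ((N z + 1) * (1 + b)) := by
      push_cast; field_simp; ring
    have k3 : (N z - 1) / (N z + 1) + ((1 + b) / (1 - b) : ℝ) =
        2 * (N z + b) / ((N z + 1) * (1 - b)) := by
      push_cast; field_simp; ring
    have k4 : 1 - (N z - 1) / (N z + 1) = 2 / (N z + 1) := by field_simp; ring
    rw [k2] at a2
    rw [k3] at a3
    rw [k1, k2, k3, k4]
    have n2 : N z - b ≠ 0 := fun h => a2 (by rw [h]; simp)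
    have n3 : N z + b ≠ 0 := fun h => a3 (by rw [h]; simp)
    have h7 : (N z - b) * (N z + b) = (1 - b ^ 2) * M z ^ 2 := by linear_combination h3
    have h8 : 2 * N z / (N z + 1) * (2 * (N z - b) / ((N z + 1) * (1 + b))) *
        (2 * (N z + b) / ((N z + 1) * (1 - b))) = 8 * N z * M z ^ 2 / (N z + 1) ^ 3 := by
      field_simp
      linear_combination 8 * h7
    rw [h8]
    field_simp
    linear_combination 8 * h3
  · intro w hw him
    have hw1 := h1z w hw
    have hwN : 0 < ((1 + w) / (1 - w)).re := re_one_add_div_one_sub_pos (by simpa using hw)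
    set n : ℂ := (1 + w) / (1 - w) with hn
    have hnim : n.im ≠ 0 := by
      intro h
      have e : w * (n + 1) = n - 1 := by rw [hn]; field_simp; ring
      have e' := congrArg im e
      rw [mul_im, add_im, sub_im, h, add_re] at e'
      simp at e'
      rcases e' with e' | e'
      · exact him e'
      · linarith
    set Q : ℂ := ((1 - b ^ 2 : ℝ) : ℂ)⁻¹ * (n ^ 2 - (b ^ 2 : ℝ)) with hQ
    have hQs : Q ∈ slitPlane := by
      rw [mem_slitPlane_iff]
      right
      rw [hQ, ← ofReal_inv, im_ofReal_mul, sub_im, ofReal_im, sub_zero, pow_two n, mul_im]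
      have := mul_ne_zero hwN.ne' hnim
      have h2 : n.re * n.im + n.im * n.re = 2 * (n.re * n.im) := by ring
      rw [h2]
      positivity
    set m := slitSqrt Q with hm
    have hmre : 0 < m.re := slitSqrt_re_pos hQs
    have hmsq : m ^ 2 = Q := slitSqrt_sq (slitPlane_ne_zero hQs)
    have hm1 := (hne m hmre).2
    have hz : (m - 1) / (m + 1) ∈ ball (0 : ℂ) 1 := by
      simpa using norm_sub_one_div_add_one_lt hmre
    refine ⟨(m - 1) / (m + 1), hz, ?_⟩
    have hMz : M ((m - 1) / (m + 1)) = m := by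
      simp only [hM]
      have h2 : 1 - (m - 1) / (m + 1) = 2 / (m + 1) := by field_simp; ring
      have h3 : 1 + (m - 1) / (m + 1) = 2 * m / (m + 1) := by field_simp; ring
      rw [h2, h3]; field_simp
    have hNz : N ((m - 1) / (m + 1)) = n := by
      refine slitSqrt_eq_of_sq hwN (hPs _ hz) ?_
      simp only [hP]
      rw [hMz, hmsq, hQ]
      have : ((1 - b ^ 2 : ℝ) : ℂ) ≠ 0 := ofReal_ne_zero.2 hbb.ne'
      field_simp
      ring
    simp only [hNz]
    rw [hn]
    have h2 : (1 + w) / (1 - w) - 1 = 2 * w / (1 - w) := by field_simp; ring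
    have h3 : (1 + w) / (1 - w) + 1 = 2 / (1 - w) := by field_simp; ring
    rw [h2, h3]
    field_simp

theorem exists_mem_one_sub_mul_eq_one {K : Set ℂ} [CompactSpace K] {A : Subalgebra ℂ C(K, ℂ)}
    (hA : IsClosed (A : Set C(K, ℂ))) {x : C(K, ℂ)} (hx : x ∈ A) (hx1 : ‖x‖ < 1) :
    ∃ y ∈ A, (1 - x) * y = 1 := by
  refine ⟨∑' n : ℕ, x ^ n, ?_, mul_neg_geom_series x hx1⟩
  exact hA.mem_of_tendsto (summable_geometric_of_norm_lt_one hx1).hasSum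
    (Eventually.of_forall fun s => sum_mem fun i _ => pow_mem hx i)

/-- A Runge type theorem: a rational function with poles on a ray is a uniform limit of polynomials
on a compact set avoiding that ray. -/
theorem exists_polynomial_approx {K : Set ℂ} (hK : IsCompact K) {s : ℝ}
    (havoid : ∀ w ∈ K, ∀ t : ℝ, s ≤ t → w + t ≠ 0) (A : Polynomial ℂ) {a₁ a₂ a₃ : ℝ}
    (h₁ : s ≤ a₁) (h₂ : s ≤ a₂) (h₃ : s ≤ a₃) {κ : ℝ} (hκ : 0 < κ) :
    ∃ p : Polynomial ℂ, ∀ w ∈ K,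
      ‖p.eval w - A.eval w / ((w + a₁) * (w + a₂) * (w + a₃))‖ < κ := by
  have : CompactSpace K := isCompact_iff_compactSpace.1 hK
  set B : Subalgebra ℂ C(K, ℂ) := (polynomialFunctions K).topologicalClosure with hB
  have hBc : IsClosed (B : Set C(K, ℂ)) := Subalgebra.isClosed_topologicalClosure _
  have hpoly : ∀ p : Polynomial ℂ, p.toContinuousMapOn K ∈ B := fun p =>
    Subalgebra.le_topologicalClosure _ ⟨p, by simp, rfl⟩
  have hray : IsClosed ((fun t : ℝ => -(t : ℂ)) '' Ici s) := by
    refine (Topology.IsClosedEmbedding.isClosedMap ?_) _ isClosed_Ici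
    exact (Homeomorph.neg ℂ).isClosedEmbedding.comp Complex.isometry_ofReal.isClosedEmbedding
  have hdisj : Disjoint K ((fun t : ℝ => -(t : ℂ)) '' Ici s) := by
    rw [Set.disjoint_left]
    rintro w hw ⟨t, ht, rfl⟩
    exact havoid _ hw t ht (by simp)
  obtain ⟨d, hd, hdist⟩ := Metric.exists_pos_forall_lt_edist hK hray hdisj
  have hdn : ∀ w ∈ K, ∀ t : ℝ, s ≤ t → (d : ℝ) ≤ ‖w + t‖ := by
    intro w hw t ht
    have := hdist w hw _ ⟨t, ht, rfl⟩
    rw [edist_nndist, ENNReal.coe_lt_coe] at this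
    have h : (d : ℝ) < nndist w (-(t : ℂ)) := NNReal.coe_lt_coe.2 this
    rw [coe_nndist, dist_eq_norm, sub_neg_eq_add] at h
    exact h.le
  obtain ⟨C, hC⟩ := hK.isBounded.exists_norm_le
  have hstep : ∀ t t' : ℝ, s ≤ t → |t - t'| < d →
      (∃ f ∈ B, ∀ w : K, f w * ((w : ℂ) + t) = 1) →
      ∃ f ∈ B, ∀ w : K, f w * ((w : ℂ) + t') = 1 := by
    rintro t t' ht htt ⟨f, hf, hfw⟩
    have hx : (((t - t' : ℝ) : ℂ) • f) ∈ B := B.smul_mem hf _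
    have hx1 : ‖(((t - t' : ℝ) : ℂ) • f)‖ < 1 := by
      rw [ContinuousMap.norm_lt_iff _ one_pos]
      intro w
      rw [ContinuousMap.smul_apply, smul_eq_mul, norm_mul, norm_real, Real.norm_eq_abs]
      have h1 := congrArg norm (hfw w)
      rw [norm_mul, norm_one] at h1
      have h2 := hdn w w.2 t ht
      have hd' : (0 : ℝ) < d := hd
      have h3 : 0 < ‖f w‖ := by
        by_contra! hc
        nlinarith [norm_nonneg ((w : ℂ) + t)]
      calc |t - t'| * ‖f w‖ < d * ‖f w‖ := by gcongr
        _ ≤ ‖(w : ℂ) + t‖ * ‖f w‖ := by gcongr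
        _ = 1 := by rw [mul_comm]; exact h1
    obtain ⟨y, hy, hxy⟩ := exists_mem_one_sub_mul_eq_one hBc hx hx1
    refine ⟨f * y, mul_mem hf hy, fun w => ?_⟩
    have h1 := DFunLike.congr_fun hxy w
    simp only [ContinuousMap.mul_apply, ContinuousMap.sub_apply, ContinuousMap.one_apply,
      ContinuousMap.smul_apply, smul_eq_mul] at h1 ⊢
    have h2 := hfw w
    push_cast at h1
    linear_combination h1 + (y w) * h2
  have hlarge : ∀ t : ℝ, max C 0 + 1 ≤ t → ∃ f ∈ B, ∀ w : K, f w * ((w : ℂ) + t) = 1 := by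
    intro t ht
    have ht0 : 0 < t := lt_of_lt_of_le (by positivity) ht
    have hx : ((-Polynomial.C (t : ℂ)⁻¹ * Polynomial.X).toContinuousMapOn K) ∈ B := hpoly _
    have hx1 : ‖((-Polynomial.C (t : ℂ)⁻¹ * Polynomial.X).toContinuousMapOn K)‖ < 1 := by
      rw [ContinuousMap.norm_lt_iff _ one_pos]
      intro w
      have h1 := hC w w.2
      have h2 := le_max_left C 0
      simp only [Polynomial.toContinuousMapOn_apply, Polynomial.toContinuousMap_apply,
        Polynomial.eval_mul, Polynomial.eval_neg, Polynomial.eval_C, Polynomial.eval_X]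
      rw [norm_mul, norm_neg, norm_inv, norm_real, Real.norm_of_nonneg ht0.le,
        inv_mul_lt_iff₀ ht0]
      linarith
    obtain ⟨y, hy, hxy⟩ := exists_mem_one_sub_mul_eq_one hBc hx hx1
    refine ⟨((t : ℂ)⁻¹) • y, B.smul_mem hy _, fun w => ?_⟩
    have h1 := DFunLike.congr_fun hxy w
    have htC : (t : ℂ) ≠ 0 := ofReal_ne_zero.2 ht0.ne'
    simp only [ContinuousMap.mul_apply, ContinuousMap.sub_apply, ContinuousMap.one_apply,
      ContinuousMap.smul_apply, smul_eq_mul, Polynomial.toContinuousMapOn_apply,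
      Polynomial.toContinuousMap_apply, Polynomial.eval_mul, Polynomial.eval_neg,
      Polynomial.eval_C, Polynomial.eval_X] at h1 ⊢
    field_simp at h1 ⊢
    linear_combination h1
  have hind : ∀ n : ℕ, ∀ t : ℝ, s ≤ t → max C 0 + 1 - n * (d / 2 : ℝ) ≤ t →
      ∃ f ∈ B, ∀ w : K, f w * ((w : ℂ) + t) = 1 := by
    intro n
    induction n with
    | zero => intro t _ ht; exact hlarge t (by simpa using ht)
    | succ n ih =>
      intro t hst ht
      have hd' : (0 : ℝ) < d := hd
      refine hstep (t + d / 2) t (by linarith) ?_ (ih _ (by linarith) ?_)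
      · rw [add_sub_cancel_left, abs_of_pos (by positivity)]; linarith
      · push_cast at ht; linarith
  have hall : ∀ t : ℝ, s ≤ t → ∃ f ∈ B, ∀ w : K, f w * ((w : ℂ) + t) = 1 := by
    intro t ht
    have hd' : (0 : ℝ) < d := hd
    obtain ⟨n, hn⟩ := exists_nat_ge ((max C 0 + 1 - t) / (d / 2))
    rw [div_le_iff₀ (by positivity)] at hn
    exact hind n t ht (by linarith)
  obtain ⟨f₁, hf₁, he₁⟩ := hall _ h₁
  obtain ⟨f₂, hf₂, he₂⟩ := hall _ h₂
  obtain ⟨f₃, hf₃, he₃⟩ := hall _ h₃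
  have hF : A.toContinuousMapOn K * f₁ * f₂ * f₃ ∈ B :=
    mul_mem (mul_mem (mul_mem (hpoly A) hf₁) hf₂) hf₃
  have hF' : A.toContinuousMapOn K * f₁ * f₂ * f₃ ∈ closure (polynomialFunctions K : Set C(K, ℂ)) :=
    hF
  obtain ⟨_, ⟨p, -, rfl⟩, hp⟩ := Metric.mem_closure_iff.1 hF' κ hκ
  refine ⟨p, fun w hw => ?_⟩
  have h := (ContinuousMap.dist_apply_le_dist (x := (⟨w, hw⟩ : K))).trans_lt hp
  rw [dist_comm, dist_eq_norm] at h
  refine lt_of_eq_of_lt (congrArg norm ?_) h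
  have e₁ := he₁ ⟨w, hw⟩
  have e₂ := he₂ ⟨w, hw⟩
  have e₃ := he₃ ⟨w, hw⟩
  have n₁ := havoid w hw _ h₁
  have n₂ := havoid w hw _ h₂
  have n₃ := havoid w hw _ h₃
  have i₁ : f₁ ⟨w, hw⟩ = (w + a₁)⁻¹ := eq_inv_of_mul_eq_one_left e₁
  have i₂ : f₂ ⟨w, hw⟩ = (w + a₂)⁻¹ := eq_inv_of_mul_eq_one_left e₂
  have i₃ : f₃ ⟨w, hw⟩ = (w + a₃)⁻¹ := eq_inv_of_mul_eq_one_left e₃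
  rw [ContinuousMap.mul_apply, ContinuousMap.mul_apply, ContinuousMap.mul_apply, i₁, i₂, i₃,
    Polynomial.toContinuousMapOn_apply, Polynomial.toContinuousMap_apply]
  change p.eval w - _ = p.eval w - _
  field_simp

open Topology in
/-- Straightening of a slit disk by a map `w ↦ w exp (H w)` with `H` entire and no critical
points. -/
theorem exists_entire_straightening {b : ℝ} (hb0 : 0 < b) (hb1 : b < 1) :
    ∃ χ₀ : ℂ → ℂ, DifferentiableOn ℂ χ₀ (ball 0 1) ∧
      (∀ z ∈ ball (0 : ℂ) 1, χ₀ z ∈ ball (0 : ℂ) 1) ∧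
      (∀ z ∈ ball (0 : ℂ) 1, ∀ t : ℝ, (1 - b) / (1 + b) ≤ t → χ₀ z + t ≠ 0) ∧
      (∀ w ∈ ball (0 : ℂ) 1, w.im ≠ 0 → ∃ z ∈ ball (0 : ℂ) 1, χ₀ z = w) ∧
      ∀ r₂ : ℝ, 0 ≤ r₂ → r₂ < 1 → ∃ (H χ : ℂ → ℂ) (ρ : ℝ), 1 < ρ ∧ Differentiable ℂ H ∧
        (∀ w, 1 + w * deriv H w ≠ 0) ∧ DifferentiableOn ℂ χ (ball 0 ρ) ∧ χ 0 = 0 ∧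
        (∀ ζ ∈ ball (0 : ℂ) ρ, χ ζ * exp (H (χ ζ)) = ζ) ∧
        (∀ ζ ∈ ball (0 : ℂ) ρ, ∃ z ∈ ball (0 : ℂ) 1, χ₀ z = χ ζ) ∧
        χ₀ '' closedBall 0 r₂ ⊆ χ '' closedBall 0 1 := by
  obtain ⟨χ₀, v, L, hχ₀, hv, hL, hmaps, hzv, hv0, hχ', hL0, hL', havoid, hsurj⟩ :=
    exists_slit_map hb0 hb1
  refine ⟨χ₀, hχ₀, hmaps, havoid, hsurj, fun r₂ hr₂0 hr₂ => ?_⟩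
  obtain ⟨r₁, hr₁⟩ : ∃ r₁, r₁ = (1 + r₂) / 2 := ⟨_, rfl⟩
  obtain ⟨κ, hκ⟩ : ∃ κ, κ = (1 - r₂) / 8 := ⟨_, rfl⟩
  have hκ0 : 0 < κ := by rw [hκ]; linarith
  have hκ1 : κ ≤ 1 / 8 := by rw [hκ]; linarith
  have hr₁0 : 0 < r₁ := by rw [hr₁]; linarith
  have hr₁1 : r₁ < 1 := by rw [hr₁]; linarith
  have hsub : closedBall (0 : ℂ) r₁ ⊆ ball 0 1 := closedBall_subset_ball hr₁1
  have h0b : (0 : ℂ) ∈ ball (0 : ℂ) 1 := by simp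
  have hd : ∀ {F : ℂ → ℂ}, DifferentiableOn ℂ F (ball 0 1) → ∀ z ∈ ball (0 : ℂ) 1,
      HasDerivAt F (deriv F z) z := fun hF z hz =>
    (hF.differentiableAt (isOpen_ball.mem_nhds hz)).hasDerivAt
  obtain ⟨D, hD⟩ := (isCompact_closedBall (0 : ℂ) r₁).exists_bound_of_continuousOn
    (f := deriv χ₀) ((hχ₀.deriv isOpen_ball).continuousOn.mono hsub)
  have hD0 : 0 ≤ D := (norm_nonneg _).trans (hD 0 (by simpa using hr₁0.le))
  have hs1 : (1 - b) / (1 + b) ≤ 1 := by rw [div_le_one (by linarith)]; linarith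
  have hs2 : (1 - b) / (1 + b) ≤ (1 + b) / (1 - b) := by
    rw [div_le_div_iff₀ (by linarith) (by linarith)]; nlinarith
  have hKc : IsCompact (χ₀ '' closedBall 0 r₁) :=
    (isCompact_closedBall (0 : ℂ) r₁).image_of_continuousOn (hχ₀.continuousOn.mono hsub)
  obtain ⟨p, hp⟩ := exists_polynomial_approx hKc (s := (1 - b) / (1 + b))
    (by rintro _ ⟨z, hz, rfl⟩ t ht; exact havoid z (hsub hz) t ht)
    (-(Polynomial.C (2 * b ^ 2 / (1 - b ^ 2) : ℂ) * (1 - Polynomial.X))) hs1 le_rfl hs2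
    (κ := κ / 8 / (D + 1)) (by positivity)
  obtain ⟨g, hg0, hg⟩ := exists_entire_primitive (g := fun w => p.eval w) p.differentiable 0
  have hgd : Differentiable ℂ g := fun w => (hg w).differentiableAt
  have hds : Differentiable ℂ (dslope (fun w => exp (g w)) 0) := by
    rw [← differentiableOn_univ, Complex.differentiableOn_dslope univ_mem]
    exact hgd.cexp.differentiableOn
  obtain ⟨H, hH0, hH⟩ := exists_entire_primitive hds 0
  have hwH : ∀ w, w * dslope (fun w => exp (g w)) 0 w = exp (g w) - 1 := by
    intro w
    have := sub_smul_dslope (fun w => exp (g w)) 0 w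
    simpa [hg0] using this
  -- the logarithmic derivative of `E` is small
  set E : ℂ → ℂ := fun z => exp (g (χ₀ z)) * L z with hE
  have hEd : ∀ z ∈ ball (0 : ℂ) 1, HasDerivAt E
      (E z * (deriv χ₀ z * (p.eval (χ₀ z) + 2 * b ^ 2 / (1 - b ^ 2) * (1 - χ₀ z) /
        ((χ₀ z + (1 : ℝ)) * (χ₀ z + ((1 - b) / (1 + b) : ℝ)) *
          (χ₀ z + ((1 + b) / (1 - b) : ℝ)))))) z := by
    intro z hz
    have h1 := ((hg (χ₀ z)).comp z (hd hχ₀ z hz)).cexp.fun_mul (hd hL z hz)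
    refine h1.congr_deriv ?_
    rw [hL' z hz]
    simp only [Function.comp, hE]
    ring
  have hE1 : ∀ z ∈ closedBall (0 : ℂ) r₁, ‖E z - 1‖ ≤ 2 * (κ / 8) * ‖z‖ := by
    have hχ00 : χ₀ 0 = 0 := by rw [hzv 0 h0b, zero_mul]
    refine fun z hz => (norm_sub_one_le_of_norm_deriv_le
      (fun z hz => (hEd z hz).differentiableAt.differentiableWithinAt)
      (by simp [hE, hχ00, hg0, hL0]) hr₁0.le hr₁1 (by positivity) (by linarith)
      (fun z hz => ?_) z hz).1
    rw [(hEd z (hsub hz)).deriv, norm_mul, mul_comm]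
    refine mul_le_mul_of_nonneg_right ?_ (norm_nonneg _)
    have h1 := (hp _ ⟨z, hz, rfl⟩).le
    rw [norm_mul]
    have h2 : p.eval (χ₀ z) - (-(Polynomial.C (2 * b ^ 2 / (1 - b ^ 2) : ℂ) *
        (1 - Polynomial.X))).eval (χ₀ z) / ((χ₀ z + (1 : ℝ)) *
        (χ₀ z + ((1 - b) / (1 + b) : ℝ)) * (χ₀ z + ((1 + b) / (1 - b) : ℝ))) =
        p.eval (χ₀ z) + 2 * b ^ 2 / (1 - b ^ 2) * (1 - χ₀ z) /
        ((χ₀ z + (1 : ℝ)) * (χ₀ z + ((1 - b) / (1 + b) : ℝ)) *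
          (χ₀ z + ((1 + b) / (1 - b) : ℝ))) := by
      simp only [Polynomial.eval_neg, Polynomial.eval_mul, Polynomial.eval_C, Polynomial.eval_sub,
        Polynomial.eval_one, Polynomial.eval_X]
      ring
    rw [h2] at h1
    calc _ ≤ D * (κ / 8 / (D + 1)) := mul_le_mul (hD z hz) h1 (norm_nonneg _) hD0
      _ ≤ (D + 1) * (κ / 8 / (D + 1)) := by gcongr; linarith
      _ = κ / 8 := by field_simp
  set σ : ℂ → ℂ := fun z => v z * exp (H (χ₀ z)) with hσ
  have hHd : Differentiable ℂ H := fun w => (hH w).differentiableAt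
  have hσd : DifferentiableOn ℂ σ (ball 0 1) :=
    hv.fun_mul (hHd.comp_differentiableOn hχ₀).cexp
  have hσ0 : ∀ z ∈ ball (0 : ℂ) 1, σ z ≠ 0 := fun z hz => mul_ne_zero (hv0 z hz) (exp_ne_zero _)
  have hσE : ∀ z ∈ ball (0 : ℂ) 1, HasDerivAt (fun z => z * σ z) (σ z * E z) z := by
    intro z hz
    have h1 : HasDerivAt (fun z => χ₀ z * exp (H (χ₀ z))) (σ z * E z) z := by
      have h2 := (hd hχ₀ z hz).fun_mul ((hH (χ₀ z)).comp z (hd hχ₀ z hz)).cexp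
      refine h2.congr_deriv ?_
      simp only [Function.comp, hσ, hE]
      rw [hχ' z hz]
      linear_combination (exp (H (χ₀ z)) * v z * L z) * hwH (χ₀ z)
    refine h1.congr_of_eventuallyEq ?_
    filter_upwards [isOpen_ball.mem_nhds hz] with x hx
    rw [hzv x hx, ← hzv x hx, hσ]
    simp only []
    rw [← mul_assoc, ← hzv x hx]
  have hσ' : ∀ z ∈ ball (0 : ℂ) 1, z * deriv σ z = σ z * (E z - 1) := by
    intro z hz
    have h1 := (hσE z hz).unique ((hasDerivAt_id' z).fun_mul (hd hσd z hz))
    linear_combination -h1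
  have hσn : ∀ z ∈ closedBall (0 : ℂ) r₁, ‖deriv σ z‖ ≤ κ / 4 * ‖σ z‖ := by
    have hne : ∀ z ∈ closedBall (0 : ℂ) r₁, z ≠ 0 → ‖deriv σ z‖ ≤ κ / 4 * ‖σ z‖ := by
      intro z hz hz0
      have h1 := congrArg norm (hσ' z (hsub hz))
      rw [norm_mul, norm_mul] at h1
      have h2 : 0 < ‖z‖ := norm_pos_iff.2 hz0
      have h3 := hE1 z hz
      refine le_of_mul_le_mul_left ?_ h2
      rw [h1]
      calc _ ≤ ‖σ z‖ * (2 * (κ / 8) * ‖z‖) := by gcongr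
        _ = _ := by ring
    intro z hz
    rcases eq_or_ne z 0 with rfl | hz0
    · have hc1 : ContinuousAt (deriv σ) 0 :=
        ((hσd.deriv isOpen_ball).differentiableAt (isOpen_ball.mem_nhds h0b)).continuousAt
      have hc2 : ContinuousAt σ 0 :=
        (hσd.differentiableAt (isOpen_ball.mem_nhds h0b)).continuousAt
      refine le_of_tendsto_of_tendsto (b := 𝓝[≠] (0 : ℂ))
        (hc1.norm.tendsto.mono_left nhdsWithin_le_nhds)
        ((hc2.norm.tendsto.const_mul _).mono_left nhdsWithin_le_nhds) ?_
      filter_upwards [self_mem_nhdsWithin,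
        mem_nhdsWithin_of_mem_nhds (closedBall_mem_nhds (0 : ℂ) hr₁0)] with x hx hx'
      exact hne x hx' hx
    · exact hne z hz hz0
  have hσ00 := hσ0 0 h0b
  have hF := norm_sub_one_le_of_norm_deriv_le (F := fun z => σ z / σ 0)
    (hσd.div_const _) (div_self hσ00) hr₁0.le hr₁1 (τ := κ / 4) (by positivity) (by linarith)
    (fun z hz => by
      rw [deriv_div_const, norm_div, norm_div, ← mul_div_assoc]
      gcongr
      exact hσn z hz)
  have hSd : ∀ z ∈ ball (0 : ℂ) 1,
      HasDerivAt (fun z => z * σ z / σ 0) (σ z / σ 0 * E z) z := by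
    intro z hz
    refine ((hσE z hz).div_const (σ 0)).congr_deriv ?_
    ring
  obtain ⟨J, hJd, hJ, hJS, hSn⟩ := exists_inverse_of_deriv_near_one
    (F := fun z => z * σ z / σ 0) (fun z hz => (hSd z hz).differentiableAt.differentiableWithinAt)
    (by simp) hr₁0 hr₁1 hκ0.le (by linarith) (fun z hz => by
      rw [(hSd z (hsub hz)).deriv]
      have e : σ z / σ 0 * E z - 1 = σ z / σ 0 * (E z - 1) + (σ z / σ 0 - 1) := by ring
      obtain ⟨f1, f2⟩ := hF z hz
      have f3 := hE1 z hz
      have hz1 : ‖z‖ ≤ 1 := by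
        rw [mem_closedBall_zero_iff] at hz; linarith
      rw [e]
      calc _ ≤ ‖σ z / σ 0‖ * ‖E z - 1‖ + ‖σ z / σ 0 - 1‖ := by
            rw [← norm_mul]; exact norm_add_le _ _
        _ ≤ 2 * (2 * (κ / 8) * 1) + 2 * (κ / 4) * 1 := by
            gcongr
            · exact f3.trans (by gcongr)
            · exact f1.trans (by gcongr)
        _ = κ := by ring)
  obtain ⟨ρ₀, hρ₀⟩ : ∃ ρ₀, ρ₀ = r₁ * (1 - κ) ^ 2 := ⟨_, rfl⟩
  have hκ' : 0 < 1 - κ := by linarith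
  have hρ₀0 : 0 < ρ₀ := by rw [hρ₀]; positivity
  have hscale : ∀ ζ ∈ ball (0 : ℂ) (1 / (1 - κ)), (ρ₀ : ℂ) * ζ ∈ ball (0 : ℂ) ((1 - κ) * r₁) := by
    intro ζ hζ
    rw [mem_ball_zero_iff] at hζ ⊢
    rw [norm_mul, norm_real, Real.norm_of_nonneg hρ₀0.le]
    calc ρ₀ * ‖ζ‖ < ρ₀ * (1 / (1 - κ)) := by gcongr
      _ = (1 - κ) * r₁ := by rw [hρ₀]; field_simp
  have hρ₀C : (ρ₀ : ℂ) ≠ 0 := ofReal_ne_zero.2 hρ₀0.ne'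
  have hcne : σ 0 * ρ₀ ≠ 0 := mul_ne_zero hσ00 hρ₀C
  refine ⟨fun w => H w - log (σ 0 * ρ₀), fun ζ => χ₀ (J (ρ₀ * ζ)), 1 / (1 - κ), ?_,
    hHd.sub_const _, ?_, ?_, ?_, ?_, ?_, ?_⟩
  · rw [lt_div_iff₀ hκ']; linarith
  · intro w
    rw [deriv_sub_const, (hH w).deriv, hwH]
    simp [exp_ne_zero]
  · refine hχ₀.comp (hJd.comp (by fun_prop) hscale) fun ζ hζ => ?_
    exact hsub (ball_subset_closedBall (hJ _ (hscale ζ hζ)).1)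
  · have : J 0 = 0 := by
      have := hJS 0 (by simpa using hr₁0.le) (by simpa using by positivity)
      simpa using this
    simp only [mul_zero, this]
    rw [hzv 0 h0b, zero_mul]
  · intro ζ hζ
    obtain ⟨h1, h2⟩ := hJ _ (hscale ζ hζ)
    have h3 := hzv _ (hsub (ball_subset_closedBall h1))
    simp only [Complex.exp_sub, exp_log hcne]
    set x := J (ρ₀ * ζ)
    have h4 : x * σ x = χ₀ x * exp (H (χ₀ x)) := by
      rw [hσ]; simp only []; rw [← mul_assoc, ← h3]
    rw [h4] at h2
    field_simp at h2 ⊢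
    rw [h2]
  · intro ζ hζ
    exact ⟨_, hsub (ball_subset_closedBall (hJ _ (hscale ζ hζ)).1), rfl⟩
  · rintro _ ⟨x, hx, rfl⟩
    rw [mem_closedBall_zero_iff] at hx
    have hx1 : x ∈ closedBall (0 : ℂ) r₁ := by
      rw [mem_closedBall_zero_iff, hr₁]; linarith
    have h1 := hSn x hx1
    have h2 : (1 + κ) * ‖x‖ ≤ ρ₀ := by
      have : (1 + κ) * ‖x‖ ≤ (1 + κ) * r₂ := by gcongr
      refine this.trans ?_
      rw [hρ₀]
      have e1 : r₁ = r₂ + 4 * κ := by rw [hr₁, hκ]; ring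
      have e2 : r₂ = 1 - 8 * κ := by rw [hκ]; ring
      rw [e1, e2]
      nlinarith [mul_pos hκ0 hκ0, mul_pos (mul_pos hκ0 hκ0) hκ0]
    have h3 : ‖x * σ x / σ 0‖ ≤ ρ₀ := h1.trans h2
    refine ⟨(x * σ x / σ 0) / ρ₀, ?_, ?_⟩
    · rw [mem_closedBall_zero_iff, norm_div, norm_real, Real.norm_of_nonneg hρ₀0.le,
        div_le_one hρ₀0]
      exact h3
    · simp only []
      rw [mul_div_cancel₀ _ hρ₀C]
      congr 1
      refine hJS x hx1 ?_
      rw [mem_ball_zero_iff]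
      refine h3.trans_lt ?_
      rw [hρ₀]
      have : 0 < r₁ * (1 - κ) * κ := by positivity
      nlinarith

theorem volume_pow_im_eq_zero {q : ℕ} (hq : 0 < q) : volume {u : ℂ | (u ^ q).im = 0} = 0 := by
  have hsub : {u : ℂ | (u ^ q).im = 0} ⊆
      ⋃ ω ∈ Polynomial.nthRootsFinset (2 * q) (1 : ℂ), (Submodule.span ℝ {ω} : Set ℂ) := by
    intro u hu
    have hu' : (u ^ q).im = 0 := hu
    simp only [mem_iUnion, exists_prop]
    rcases eq_or_ne u 0 with rfl | hu0
    · exact ⟨1, by simp [Polynomial.mem_nthRootsFinset, hq], Submodule.zero_mem _⟩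
    · have hn : ((‖u‖ : ℝ) : ℂ) ≠ 0 := ofReal_ne_zero.2 (norm_ne_zero_iff.2 hu0)
      refine ⟨u / ‖u‖, ?_, ?_⟩
      · rw [Polynomial.mem_nthRootsFinset (by positivity), div_pow, div_eq_one_iff_eq
          (pow_ne_zero _ hn), mul_comm 2 q, pow_mul, pow_mul, ← ofReal_pow, ← norm_pow]
        have : u ^ q = ((u ^ q).re : ℂ) := by
          apply Complex.ext <;> simp [hu']
        rw [this, norm_real, ← ofReal_pow, ← ofReal_pow, Real.norm_eq_abs, sq_abs]
      · rw [SetLike.mem_coe, Submodule.mem_span_singleton]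
        exact ⟨‖u‖, by rw [real_smul]; field_simp⟩
  refine measure_mono_null hsub ?_
  refine (measure_biUnion_null_iff (μ := volume) (Finset.countable_toSet _)).2 fun ω _ => ?_
  refine Measure.addHaar_submodule _ _ fun h => ?_
  have h1 := finrank_span_le_card (R := ℝ) ({ω} : Set ℂ)
  rw [h, finrank_top, Complex.finrank_real_complex] at h1
  simp at h1

/-- An entire map without critical points, commuting with the rotations of order `q`, which
has an inverse branch mapping the unit disk onto almost all of the unit disk while omitting
a point near the origin. -/
theorem exists_symmetric_straightening {q : ℕ} (hq : 0 < q) {δ : ℝ} (hδ : 0 < δ) :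
    ∃ (Θ φ : ℂ → ℂ) (ρ : ℝ), Differentiable ℂ Θ ∧ (∀ u, deriv Θ u ≠ 0) ∧ 1 < ρ ∧
      DifferentiableOn ℂ φ (ball 0 ρ) ∧ (∀ ζ ∈ ball (0 : ℂ) ρ, φ ζ ∈ ball (0 : ℂ) 1) ∧
      φ 0 = 0 ∧ (∀ ζ ∈ ball (0 : ℂ) ρ, Θ (φ ζ) = ζ) ∧
      (∀ ω : ℂ, ω ^ q = 1 → ∀ ζ, φ (ω * ζ) = ω * φ ζ) ∧
      volume (closedBall 0 1 \ φ '' closedBall 0 1) < ENNReal.ofReal δ ∧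
      ∃ u : ℂ, ‖u‖ < δ ∧ u ∉ φ '' closedBall 0 1 := by
  obtain ⟨s, hs⟩ : ∃ s, s = min (1 / 2) (δ ^ q / 2) := ⟨_, rfl⟩
  have hs0 : 0 < s := by rw [hs]; positivity
  have hs1 : s ≤ 1 / 2 := by rw [hs]; exact min_le_left _ _
  have hsδ : s < δ ^ q := by
    have : s ≤ δ ^ q / 2 := by rw [hs]; exact min_le_right _ _
    have : 0 < δ ^ q := by positivity
    linarith
  have hb0 : 0 < (1 - s) / (1 + s) := div_pos (by linarith) (by linarith)
  have hb1 : (1 - s) / (1 + s) < 1 := by rw [div_lt_one (by linarith)]; linarith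
  have hbs : (1 - (1 - s) / (1 + s)) / (1 + (1 - s) / (1 + s)) = s := by field_simp; ring
  obtain ⟨χ₀, hχ₀, hmaps, havoid, hsurj, hstr⟩ := exists_entire_straightening hb0 hb1
  rw [hbs] at havoid
  set A : ℕ → Set ℂ := fun j =>
    closedBall 0 1 \ (fun u => u ^ q) ⁻¹' (χ₀ '' closedBall 0 (1 - 1 / ((j : ℝ) + 1))) with hA
  have hr : ∀ j : ℕ, 0 ≤ 1 - 1 / ((j : ℝ) + 1) ∧ 1 - 1 / ((j : ℝ) + 1) < 1 := by
    intro j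
    have : (0 : ℝ) < j + 1 := by positivity
    refine ⟨?_, ?_⟩
    · rw [sub_nonneg, div_le_one this]; linarith [(Nat.cast_nonneg j : (0 : ℝ) ≤ j)]
    · have : 0 < 1 / ((j : ℝ) + 1) := by positivity
      linarith
  have hAmeas : ∀ j, MeasurableSet (A j) := by
    intro j
    refine isClosed_closedBall.measurableSet.diff ?_
    have : IsCompact (χ₀ '' closedBall 0 (1 - 1 / ((j : ℝ) + 1))) :=
      (isCompact_closedBall _ _).image_of_continuousOn
        (hχ₀.continuousOn.mono (closedBall_subset_ball (hr j).2))
    exact (this.isClosed.preimage (continuous_pow q)).measurableSet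
  have hAanti : Antitone A := by
    intro i j hij
    refine sdiff_subset_sdiff_right (preimage_mono (image_mono (closedBall_subset_closedBall ?_)))
    have : (i : ℝ) ≤ j := Nat.cast_le.2 hij
    gcongr
  have hAnull : volume (⋂ j, A j) = 0 := by
    refine measure_mono_null (t := sphere 0 1 ∪ {u : ℂ | (u ^ q).im = 0}) ?_
      (measure_union_null (Measure.addHaar_sphere _ _ _) (volume_pow_im_eq_zero hq))
    intro u hu
    rw [mem_iInter] at hu
    by_contra hcon
    rw [mem_union, not_or] at hcon
    have hu1 : ‖u‖ ≤ 1 := by simpa using (hu 0).1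
    have hu2 : ‖u‖ < 1 := lt_of_le_of_ne hu1 (by simpa using hcon.1)
    have hw : u ^ q ∈ ball (0 : ℂ) 1 := by
      rw [mem_ball_zero_iff, norm_pow]
      exact pow_lt_one₀ (norm_nonneg _) hu2 hq.ne'
    obtain ⟨z, hz, hzw⟩ := hsurj _ hw hcon.2
    rw [mem_ball_zero_iff] at hz
    obtain ⟨j, hj⟩ := exists_nat_one_div_lt (sub_pos.2 hz)
    refine (hu j).2 ⟨z, ?_, hzw⟩
    rw [mem_closedBall_zero_iff]; linarith
  obtain ⟨j, hj⟩ : ∃ j, volume (A j) < ENNReal.ofReal δ := by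
    have hfin : volume (A 0) ≠ ⊤ :=
      ((measure_mono sdiff_subset).trans_lt measure_closedBall_lt_top).ne
    have := tendsto_measure_iInter_atTop (μ := volume)
      (fun j => (hAmeas j).nullMeasurableSet) hAanti ⟨0, hfin⟩
    rw [hAnull] at this
    exact (this.eventually_lt_const (ENNReal.ofReal_pos.2 hδ)).exists
  obtain ⟨H, χ, ρ', hρ', hH, hH', hχ, hχ0, hχH, hχχ₀, hχsub⟩ := hstr _ (hr j).1 (hr j).2
  have hqC : (q : ℂ) ≠ 0 := Nat.cast_ne_zero.2 hq.ne'
  obtain ⟨ρ, hρ⟩ : ∃ ρ, ρ = ρ' ^ (1 / (q : ℝ)) := ⟨_, rfl⟩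
  have hρ1 : 1 < ρ := by rw [hρ]; exact Real.one_lt_rpow hρ' (by positivity)
  have hρq : ρ ^ q = ρ' := by
    rw [hρ, one_div, Real.rpow_inv_natCast_pow (by linarith) hq.ne']
  have hpow : ∀ ζ ∈ ball (0 : ℂ) ρ, ζ ^ q ∈ ball (0 : ℂ) ρ' := by
    intro ζ hζ
    rw [mem_ball_zero_iff] at hζ ⊢
    rw [norm_pow, ← hρq]
    exact pow_lt_pow_left₀ hζ (norm_nonneg _) hq.ne'
  set φ : ℂ → ℂ := fun ζ => ζ * exp (-(H (χ (ζ ^ q)) / q)) with hφ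
  have hexpq : ∀ x : ℂ, exp (x / q) ^ q = exp x := by
    intro x
    rw [← Complex.exp_nat_mul, mul_div_cancel₀ _ hqC]
  have hφq : ∀ ζ ∈ ball (0 : ℂ) ρ, φ ζ ^ q = χ (ζ ^ q) := by
    intro ζ hζ
    have h1 := hχH _ (hpow ζ hζ)
    simp only [hφ]
    rw [mul_pow, ← neg_div, hexpq, Complex.exp_neg]
    nth_rewrite 1 [← h1]
    rw [mul_assoc, mul_inv_cancel₀ (exp_ne_zero _), mul_one]
  have hcb : closedBall (0 : ℂ) 1 ⊆ ball 0 ρ := closedBall_subset_ball hρ1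
  refine ⟨fun u => u * exp (H (u ^ q) / q), φ, ρ, ?_, ?_, hρ1, ?_, ?_, ?_, ?_, ?_, ?_, ?_⟩
  · exact differentiable_fun_id.fun_mul ((hH.comp (differentiable_pow q)).div_const _).cexp
  · intro u
    have h1 : HasDerivAt (fun u : ℂ => u * exp (H (u ^ q) / q))
        (exp (H (u ^ q) / q) * (1 + u ^ q * deriv H (u ^ q))) u := by
      have h3 : HasDerivAt (fun u => H (u ^ q)) (deriv H (u ^ q) * (q * u ^ (q - 1))) u :=
        HasDerivAt.comp (h₂ := H) (h := fun u => u ^ q) u (hH (u ^ q)).hasDerivAt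
          (hasDerivAt_pow q u)
      have h2 := (hasDerivAt_id' u).fun_mul (h3.div_const (q : ℂ)).cexp
      refine h2.congr_deriv ?_
      obtain ⟨k, rfl⟩ : ∃ k, q = k + 1 := ⟨q - 1, by omega⟩
      simp only [Nat.add_sub_cancel]
      field_simp
      ring
    rw [h1.deriv]
    exact mul_ne_zero (exp_ne_zero _) (hH' _)
  · refine differentiableOn_id.fun_mul (DifferentiableOn.cexp ?_)
    exact ((hH.comp_differentiableOn (hχ.comp (differentiable_pow q).differentiableOn
      hpow)).div_const _).fun_neg
  · intro ζ hζ
    obtain ⟨z, hz, hze⟩ := hχχ₀ _ (hpow ζ hζ)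
    have h1 := hmaps z hz
    rw [hze, ← hφq ζ hζ, mem_ball_zero_iff, norm_pow] at h1
    rw [mem_ball_zero_iff]
    by_contra! hc
    exact absurd h1 (not_lt.2 (one_le_pow₀ hc))
  · simp [hφ]
  · intro ζ hζ
    simp only []
    rw [hφq ζ hζ]
    simp only [hφ]
    rw [mul_assoc, ← Complex.exp_add, neg_add_cancel, Complex.exp_zero, mul_one]
  · intro ω hω ζ
    simp only [hφ]
    rw [mul_pow, hω, one_mul, mul_assoc]
  · refine (measure_mono ?_).trans_lt hj
    intro u hu
    refine ⟨hu.1, fun hu' => hu.2 ?_⟩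
    obtain ⟨η, hη, hηu⟩ := hχsub hu'
    have hηe : χ η = u ^ q := hηu
    have hηb : η ∈ ball (0 : ℂ) ρ' := closedBall_subset_ball hρ' hη
    have h1 : (u * exp (H (u ^ q) / q)) ^ q = η := by
      rw [mul_pow, hexpq, ← hηe, hχH η hηb]
    refine ⟨u * exp (H (u ^ q) / q), ?_, ?_⟩
    · rw [mem_closedBall_zero_iff] at hη ⊢
      rw [← h1, norm_pow] at hη
      by_contra! hc
      exact absurd hη (not_le.2 (one_lt_pow₀ hc hq.ne'))
    · simp only [hφ]
      rw [h1, hηe, mul_assoc, ← Complex.exp_add, add_neg_cancel, Complex.exp_zero, mul_one]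
  · obtain ⟨u, hu⟩ := IsAlgClosed.exists_pow_nat_eq (-(s : ℂ)) hq
    refine ⟨u, ?_, ?_⟩
    · have h1 := congrArg norm hu
      rw [norm_pow, norm_neg, norm_real, Real.norm_of_nonneg hs0.le] at h1
      rw [← h1] at hsδ
      exact lt_of_pow_lt_pow_left₀ q hδ.le hsδ
    · rintro ⟨ζ, hζ, rfl⟩
      obtain ⟨z, hz, hze⟩ := hχχ₀ _ (hpow ζ (hcb hζ))
      refine havoid z hz s le_rfl ?_
      rw [hze, ← hφq ζ (hcb hζ), hu, neg_add_cancel]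

/-- A holomorphic map distorts area on a compact disk by a bounded factor. -/
theorem exists_volume_image_le {φ : ℂ → ℂ} {ρ : ℝ} (hρ : 1 < ρ)
    (hφ : DifferentiableOn ℂ φ (ball 0 ρ)) : ∃ C : ℝ, 0 < C ∧ ∀ A ⊆ closedBall (0 : ℂ) 1,
      MeasurableSet A → volume (φ '' A) ≤ ENNReal.ofReal C * volume A := by
  have hsub : closedBall (0 : ℂ) 1 ⊆ ball 0 ρ := closedBall_subset_ball hρ
  have hcont : ContinuousOn (fun z => (deriv φ z • (1 : ℂ →L[ℝ] ℂ)).det) (closedBall 0 1) := by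
    refine ContinuousLinearMap.continuous_det.comp_continuousOn ?_
    exact ((hφ.deriv isOpen_ball).continuousOn.mono hsub).smul continuousOn_const
  obtain ⟨C, hC⟩ := (isCompact_closedBall (0 : ℂ) 1).exists_bound_of_continuousOn hcont
  have hC0 : 0 ≤ C := (norm_nonneg _).trans (hC 0 (by simp))
  refine ⟨C + 1, by linarith, fun A hA hAm => ?_⟩
  calc volume (φ '' A)
      ≤ ∫⁻ z in A, ENNReal.ofReal |(deriv φ z • (1 : ℂ →L[ℝ] ℂ)).det| :=
        addHaar_image_le_lintegral_abs_det_fderiv volume hAm fun z hz =>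
          ((hφ.differentiableAt (isOpen_ball.mem_nhds
            (hsub (hA hz)))).hasDerivAt.complexToReal_fderiv).hasFDerivWithinAt
    _ ≤ ∫⁻ _ in A, ENNReal.ofReal (C + 1) := by
        refine setLIntegral_mono measurable_const fun z hz => ENNReal.ofReal_le_ofReal ?_
        have := hC z (hA hz)
        rw [Real.norm_eq_abs] at this
        linarith
    _ = _ := by rw [setLIntegral_const]

/-- A periodic stage of the approximation by conjugation: `f` acts on the closed topological disk
`φ (closedBall 0 1)` as the rotation of angle `p / q`. -/
structure Stage where
  p : ℕ
  q : ℕ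
  f : ℂ → ℂ
  ψ : ℂ → ℂ
  φ : ℂ → ℂ
  ρ : ℝ
  M : ℝ
  q_pos : 0 < q
  one_lt : 1 < ρ
  f_diff : DifferentiableOn ℂ f (ball 0 4)
  f_bound : ∀ z ∈ ball (0 : ℂ) 4, ‖f z‖ ≤ M
  ψ_diff : Differentiable ℂ ψ
  ψ_deriv : ∀ z, deriv ψ z ≠ 0
  φ_diff : DifferentiableOn ℂ φ (ball 0 ρ)
  φ_zero : φ 0 = 0
  ψ_φ : ∀ ζ ∈ ball (0 : ℂ) ρ, ψ (φ ζ) = ζ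
  φ_maps : ∀ ζ ∈ closedBall (0 : ℂ) 1, φ ζ ∈ closedBall (0 : ℂ) 1
  f_φ : ∀ ζ ∈ closedBall (0 : ℂ) 1, f (φ ζ) = φ (exp (2 * Real.pi * I * (p / q : ℝ)) * ζ)

namespace Stage

/-- The invariant closed topological disk of a stage. -/
def disk (S : Stage) : Set ℂ := S.φ '' closedBall 0 1

/-- The identity map, as a stage. -/
def init : Stage where
  p := 0
  q := 1
  f := id
  ψ := id
  φ := id
  ρ := 2
  M := 4
  q_pos := one_pos
  one_lt := one_lt_two
  f_diff := differentiableOn_id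
  f_bound z hz := by simpa using (mem_ball_zero_iff.1 hz).le
  ψ_diff := differentiable_id
  ψ_deriv z := by simp
  φ_diff := differentiableOn_id
  φ_zero := rfl
  ψ_φ ζ _ := rfl
  φ_maps ζ hζ := hζ
  f_φ ζ _ := by simp

/-- `T` refines `S` with the precision required at step `n`. -/
structure Refines (n : ℕ) (S T : Stage) : Prop where
  dist_le : ∀ z ∈ ball (0 : ℂ) 4, ‖T.f z - S.f z‖ ≤ 1 / 2 ^ (n + 2)
  disk_subset : T.disk ⊆ S.disk
  volume_le : volume (S.disk \ T.disk) ≤ ENNReal.ofReal (1 / 2 ^ (n + 1))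
  exists_notMem : ∃ z ∉ T.disk, ‖z‖ < 1 / ((n : ℝ) + 1)
  q_le : 2 * (n + 2) * S.q ≤ T.q
  angle : (T.p / T.q : ℝ) = S.p / S.q + 1 / T.q

theorem exists_refines (S : Stage) (n : ℕ) : ∃ T, Refines n S T := by
  obtain ⟨C, hC0, hC⟩ := exists_volume_image_le S.one_lt S.φ_diff
  have hsub : closedBall (0 : ℂ) 1 ⊆ ball 0 S.ρ := closedBall_subset_ball S.one_lt
  have hφ0 : ContinuousAt S.φ 0 :=
    (S.φ_diff.differentiableAt (isOpen_ball.mem_nhds (hsub (by simp)))).continuousAt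
  obtain ⟨η, hη, hηφ⟩ := Metric.continuousAt_iff.1 hφ0 (1 / ((n : ℝ) + 1)) (by positivity)
  obtain ⟨δ, hδ⟩ : ∃ δ, δ = min (min η 1) (1 / 2 ^ (n + 1) / C) := ⟨_, rfl⟩
  have hδ0 : 0 < δ := by rw [hδ]; positivity
  have hδη : δ ≤ η := by rw [hδ]; exact (min_le_left _ _).trans (min_le_left _ _)
  have hδ1 : δ ≤ 1 := by rw [hδ]; exact (min_le_left _ _).trans (min_le_right _ _)
  have hδC : C * δ ≤ 1 / 2 ^ (n + 1) := by
    rw [mul_comm, ← le_div_iff₀ hC0, hδ]; exact min_le_right _ _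
  obtain ⟨Θ, φ, ρ, hΘ, hΘ', hρ, hφ, hmaps, hφz, hΘφ, hsymm, hvol, u, hu, huφ⟩ :=
    exists_symmetric_straightening S.q_pos hδ0
  have hsub' : closedBall (0 : ℂ) 1 ⊆ ball 0 ρ := closedBall_subset_ball hρ
  have hmaps' : ∀ ζ ∈ ball (0 : ℂ) ρ, φ ζ ∈ closedBall (0 : ℂ) 1 := fun ζ hζ =>
    ball_subset_closedBall (hmaps ζ hζ)
  obtain ⟨R, hR⟩ : ∃ R, R = max S.M 1 + 1 := ⟨_, rfl⟩
  have hRM : S.M < R := by rw [hR]; linarith [le_max_left S.M 1]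
  have hR1 : 1 < R := by rw [hR]; linarith [le_max_right S.M 1]
  have hψd : Differentiable ℂ (Θ ∘ S.ψ) := hΘ.comp S.ψ_diff
  have hψ' : ∀ z, deriv (Θ ∘ S.ψ) z ≠ 0 := by
    intro z
    rw [deriv_comp z (hΘ _) (S.ψ_diff z)]
    exact mul_ne_zero (hΘ' _) (S.ψ_deriv z)
  have hφd : DifferentiableOn ℂ (S.φ ∘ φ) (ball 0 ρ) :=
    S.φ_diff.comp hφ fun ζ hζ => hsub (hmaps' ζ hζ)
  have hψφ : ∀ ζ ∈ ball (0 : ℂ) ρ, (Θ ∘ S.ψ) ((S.φ ∘ φ) ζ) = ζ := by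
    intro ζ hζ
    simp only [Function.comp]
    rw [S.ψ_φ _ (hsub (hmaps' ζ hζ)), hΘφ ζ hζ]
  obtain ⟨ε₀, hε₀, hg⟩ := exists_lift_rotation hψd hψ' hρ hφd hψφ (R := R) (by linarith)
    (fun ζ hζ => closedBall_subset_ball hR1 (S.φ_maps _ (hmaps' ζ (hsub' hζ))))
    (δ := 1 / 2 ^ (n + 2)) (by positivity)
  obtain ⟨k, hk⟩ := exists_nat_gt (1 / ε₀)
  have hqR : (0 : ℝ) < S.q := Nat.cast_pos.2 S.q_pos
  obtain ⟨m, hm⟩ : ∃ m, m = max k (2 * (n + 2)) := ⟨_, rfl⟩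
  have hm2 : 2 * (n + 2) ≤ m := by rw [hm]; exact le_max_right _ _
  have hm0 : 0 < m := by omega
  have hmk : (1 / ε₀ : ℝ) < m := hk.trans_le (Nat.cast_le.2 (by rw [hm]; exact le_max_left _ _))
  have hmR : (0 : ℝ) < m := Nat.cast_pos.2 hm0
  obtain ⟨g, hgd, hgn, hgφ⟩ := hg (1 / (S.q * m)) (by positivity) (by
    rw [div_lt_iff₀ (by positivity)]
    rw [div_lt_iff₀ hε₀] at hmk
    have : (1 : ℝ) ≤ S.q := by exact_mod_cast S.q_pos
    calc 1 < m * ε₀ := hmk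
      _ ≤ ε₀ * (S.q * m) := by nlinarith [mul_pos hε₀ hmR])
  have hfR : ∀ z ∈ ball (0 : ℂ) 4, S.f z ∈ ball (0 : ℂ) R := fun z hz => by
    rw [mem_ball_zero_iff]; exact (S.f_bound z hz).trans_lt hRM
  have hangle : ((S.p * m + 1 : ℕ) / (S.q * m : ℕ) : ℝ) = S.p / S.q + 1 / (S.q * m) := by
    push_cast; field_simp
  set l : ℂ := exp (2 * Real.pi * I * (S.p / S.q : ℝ)) with hl
  have hlq : l ^ S.q = 1 := by
    rw [hl, ← Complex.exp_nat_mul, Complex.exp_eq_one_iff]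
    refine ⟨S.p, ?_⟩
    have : (S.q : ℂ) ≠ 0 := Nat.cast_ne_zero.2 S.q_pos.ne'
    push_cast
    field_simp
  have hl1 : ‖l‖ = 1 := Complex.norm_eq_one_of_pow_eq_one hlq S.q_pos.ne'
  have hconj : ∀ ζ ∈ closedBall (0 : ℂ) 1, (g ∘ S.f) ((S.φ ∘ φ) ζ) =
      (S.φ ∘ φ) (exp (2 * Real.pi * I * ((S.p * m + 1 : ℕ) / (S.q * m : ℕ) : ℝ)) * ζ) := by
    intro ζ hζ
    have hlζ : l * ζ ∈ closedBall (0 : ℂ) 1 := by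
      rw [mem_closedBall_zero_iff] at hζ ⊢
      rwa [norm_mul, hl1, one_mul]
    have h1 : (g ∘ S.f) ((S.φ ∘ φ) ζ) = g ((S.φ ∘ φ) (l * ζ)) := by
      simp only [Function.comp]
      rw [S.f_φ _ (hmaps' ζ (hsub' hζ)), ← hl, hsymm l hlq]
    rw [h1, hgφ _ hlζ, ← mul_assoc, hl, ← Complex.exp_add]
    congr 3
    rw [hangle]
    push_cast
    ring
  refine ⟨⟨S.p * m + 1, S.q * m, g ∘ S.f, Θ ∘ S.ψ, S.φ ∘ φ, ρ, R + 1, Nat.mul_pos S.q_pos hm0, hρ,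
    hgd.comp S.f_diff hfR, ?_, hψd, hψ', hφd, ?_, hψφ, ?_, hconj⟩, ?_, ?_, ?_, ?_, ?_, ?_⟩
  · intro z hz
    have h1 := hgn _ (hfR z hz)
    have h2 := mem_ball_zero_iff.1 (hfR z hz)
    have h3 := norm_add_le (g (S.f z) - S.f z) (S.f z)
    rw [sub_add_cancel] at h3
    have h4 : (1 : ℝ) / 2 ^ (n + 2) ≤ 1 := by
      rw [div_le_one (by positivity)]; exact one_le_pow₀ one_le_two
    simp only [Function.comp]
    linarith
  · simp [hφz, S.φ_zero]
  · exact fun ζ hζ => S.φ_maps _ (hmaps' ζ (hsub' hζ))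
  · exact fun z hz => hgn _ (hfR z hz)
  · rintro _ ⟨ζ, hζ, rfl⟩
    exact ⟨φ ζ, hmaps' ζ (hsub' hζ), rfl⟩
  · have hcomp : IsCompact (φ '' closedBall 0 1) :=
      (isCompact_closedBall _ _).image_of_continuousOn (hφ.continuousOn.mono hsub')
    calc _ ≤ volume (S.φ '' (closedBall 0 1 \ φ '' closedBall 0 1)) := by
          refine measure_mono ?_
          rintro _ ⟨⟨x, hx, rfl⟩, hx'⟩
          refine ⟨x, ⟨hx, ?_⟩, rfl⟩
          rintro ⟨ζ, hζ, rfl⟩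
          exact hx' ⟨ζ, hζ, rfl⟩
      _ ≤ ENNReal.ofReal C * volume (closedBall 0 1 \ φ '' closedBall 0 1) :=
          hC _ sdiff_subset (isClosed_closedBall.measurableSet.diff hcomp.isClosed.measurableSet)
      _ ≤ ENNReal.ofReal C * ENNReal.ofReal δ := by gcongr
      _ ≤ _ := by
          rw [← ENNReal.ofReal_mul hC0.le]
          exact ENNReal.ofReal_le_ofReal hδC
  · refine ⟨S.φ u, ?_, ?_⟩
    · rintro ⟨ζ, hζ, hζu⟩
      have h1 := congrArg S.ψ hζu
      simp only [Function.comp] at h1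
      rw [S.ψ_φ _ (hsub (hmaps' ζ (hsub' hζ))),
        S.ψ_φ _ (hsub (by rw [mem_closedBall_zero_iff]; linarith))] at h1
      exact huφ ⟨ζ, hζ, h1⟩
    · have := hηφ (x := u) (by rw [dist_zero_right]; linarith)
      rwa [S.φ_zero, dist_zero_right] at this
  · simp only []
    rw [mul_comm S.q]
    gcongr
  · simp only []
    rw [hangle]; push_cast; rfl

end Stage

namespace Stage

variable (S : Stage)

theorem closedBall_subset : closedBall (0 : ℂ) 1 ⊆ ball 0 S.ρ := closedBall_subset_ball S.one_lt

theorem isCompact_disk : IsCompact S.disk :=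
  (isCompact_closedBall _ _).image_of_continuousOn (S.φ_diff.continuousOn.mono S.closedBall_subset)

theorem isPreconnected_disk : IsPreconnected S.disk :=
  (convex_closedBall _ _).isPreconnected.image _
    (S.φ_diff.continuousOn.mono S.closedBall_subset)

theorem zero_mem_disk : (0 : ℂ) ∈ S.disk := ⟨0, by simp, S.φ_zero⟩

theorem disk_subset_closedBall : S.disk ⊆ closedBall 0 1 := by
  rintro _ ⟨ζ, hζ, rfl⟩
  exact S.φ_maps ζ hζ

theorem injOn_φ : InjOn S.φ (ball 0 S.ρ) := fun x hx y hy h => by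
  rw [← S.ψ_φ x hx, h, S.ψ_φ y hy]

theorem isConnected_compl_disk : IsConnected S.diskᶜ := by
  have hopen : IsOpen (S.φ '' ball 0 S.ρ) := by
    rcases (S.φ_diff.analyticOnNhd isOpen_ball).is_constant_or_isOpen
      (convex_ball _ _).isPreconnected with ⟨w, hw⟩ | ho
    · have h0 : (0 : ℂ) ∈ ball (0 : ℂ) S.ρ := S.closedBall_subset (by simp)
      have h1 : (1 : ℂ) ∈ ball (0 : ℂ) S.ρ := S.closedBall_subset (by simp)
      exact absurd (S.injOn_φ h0 h1 ((hw _ h0).trans (hw _ h1).symm)) zero_ne_one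
    · exact ho _ Subset.rfl isOpen_ball
  refine isConnected_compl_of_diff S.isCompact_disk.isClosed ⟨0, S.zero_mem_disk⟩ hopen
    (image_mono S.closedBall_subset) ?_
  have : S.φ '' ball 0 S.ρ \ S.disk = S.φ '' (ball 0 S.ρ \ closedBall 0 1) :=
    (S.injOn_φ.image_sdiff_subset S.closedBall_subset).symm
  rw [this]
  exact (isConnected_annulus S.one_lt).image _ (S.φ_diff.continuousOn.mono sdiff_subset)

theorem norm_exp_angle (x : ℝ) : ‖exp (2 * Real.pi * I * x)‖ = 1 := by
  have : exp (2 * Real.pi * I * x) = exp ((2 * Real.pi * x : ℝ) * I) := by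
    congr 1; push_cast; ring
  rw [this, norm_exp_ofReal_mul_I]

theorem image_disk : S.f '' S.disk = S.disk := by
  set l : ℂ := exp (2 * Real.pi * I * (S.p / S.q : ℝ)) with hl
  have hl1 : ‖l‖ = 1 := norm_exp_angle _
  have hl0 : l ≠ 0 := exp_ne_zero _
  apply Subset.antisymm
  · rintro _ ⟨_, ⟨ζ, hζ, rfl⟩, rfl⟩
    refine ⟨l * ζ, ?_, (S.f_φ ζ hζ).symm⟩
    rw [mem_closedBall_zero_iff] at hζ ⊢
    rwa [norm_mul, hl1, one_mul]
  · rintro _ ⟨ζ, hζ, rfl⟩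
    have h : l⁻¹ * ζ ∈ closedBall (0 : ℂ) 1 := by
      rw [mem_closedBall_zero_iff] at hζ ⊢
      rwa [norm_mul, norm_inv, hl1, inv_one, one_mul]
    exact ⟨S.φ (l⁻¹ * ζ), ⟨_, h, rfl⟩, by rw [S.f_φ _ h, ← hl, mul_inv_cancel_left₀ hl0]⟩

theorem f_zero : S.f 0 = 0 := by
  have := S.f_φ 0 (by simp)
  rwa [mul_zero, S.φ_zero] at this

theorem deriv_f_zero : deriv S.f 0 = exp (2 * Real.pi * I * (S.p / S.q : ℝ)) := by
  set l : ℂ := exp (2 * Real.pi * I * (S.p / S.q : ℝ)) with hl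
  have h0 : (0 : ℂ) ∈ ball (0 : ℂ) S.ρ := S.closedBall_subset (by simp)
  have hφ : HasDerivAt S.φ (deriv S.φ 0) 0 :=
    (S.φ_diff.differentiableAt (isOpen_ball.mem_nhds h0)).hasDerivAt
  have hf : HasDerivAt S.f (deriv S.f 0) 0 :=
    (S.f_diff.differentiableAt (isOpen_ball.mem_nhds (by simp))).hasDerivAt
  have hne : deriv S.φ 0 ≠ 0 := by
    have h1 := HasDerivAt.comp 0 (S.ψ_diff (S.φ 0)).hasDerivAt hφ
    have h2 : HasDerivAt (S.ψ ∘ S.φ) 1 0 := by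
      refine (hasDerivAt_id (0 : ℂ)).congr_of_eventuallyEq ?_
      filter_upwards [isOpen_ball.mem_nhds h0] with x hx using S.ψ_φ x hx
    have h3 := h1.unique h2
    intro h4
    rw [h4, mul_zero] at h3
    exact zero_ne_one h3
  have h1 : HasDerivAt (S.f ∘ S.φ) (deriv S.f 0 * deriv S.φ 0) 0 :=
    HasDerivAt.comp 0 (by rw [S.φ_zero]; exact hf) hφ
  have h2 : HasDerivAt (fun ζ => S.φ (l * ζ)) (deriv S.φ 0 * (l * 1)) 0 :=
    HasDerivAt.comp (h₂ := S.φ) (h := fun ζ => l * ζ) 0 (by rw [mul_zero]; exact hφ)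
      ((hasDerivAt_id' (0 : ℂ)).const_mul l)
  have h3 : (S.f ∘ S.φ) =ᶠ[nhds 0] fun ζ => S.φ (l * ζ) := by
    filter_upwards [closedBall_mem_nhds (0 : ℂ) one_pos] with x hx using S.f_φ x hx
  have h4 := h1.unique (h2.congr_of_eventuallyEq h3)
  refine mul_right_cancel₀ hne (h4.trans ?_)
  ring

end Stage

/-- A number with too good rational approximations from below is irrational. -/
theorem irrational_of_approx {α : ℝ} {p q : ℕ → ℕ} (hq : ∀ n, 0 < q n)
    (h1 : ∀ n, (p n / q n : ℝ) < α)
    (h2 : ∀ n : ℕ, α ≤ p n / q n + 1 / ((n + 2) * q n)) : Irrational α := by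
  rintro ⟨x, rfl⟩
  set n := x.den with hn
  have hqn : (0 : ℝ) < q n := Nat.cast_pos.2 (hq n)
  have hd : (0 : ℝ) < x.den := Nat.cast_pos.2 x.den_pos
  have hx : (x : ℝ) = x.num / x.den := by exact_mod_cast (Rat.num_div_den x).symm
  have e1 := h1 n
  have e2 := h2 n
  rw [hx, div_lt_div_iff₀ hqn hd] at e1
  have e3 : (1 : ℤ) ≤ x.num * q n - p n * x.den := by
    have : (p n : ℤ) * x.den < x.num * q n := by exact_mod_cast e1
    linarith
  have e4 : (1 : ℝ) ≤ x.num * q n - p n * x.den := by exact_mod_cast e3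
  rw [hx] at e2
  have e5 : (x.num : ℝ) * q n - p n * x.den ≤ x.den / (n + 2) := by
    have : (x.num / x.den : ℝ) * (q n * x.den) ≤
        (p n / q n + 1 / ((n + 2) * q n)) * (q n * x.den) := by gcongr
    have r1 : (x.num / x.den : ℝ) * (q n * x.den) = x.num * q n := by field_simp
    have r2 : (p n / q n + 1 / ((n + 2) * q n)) * (q n * x.den) =
        (p n * x.den + x.den / (n + 2) : ℝ) := by field_simp
    linarith
  have e6 : (x.den / (n + 2) : ℝ) < 1 := by
    rw [div_lt_one (by positivity), hn]; linarith
  linarith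

theorem exists_stage_sequence :
    ∃ S : ℕ → Stage, S 0 = Stage.init ∧ ∀ n, Stage.Refines n (S n) (S (n + 1)) := by
  choose T hT using fun (S : Stage) (n : ℕ) => S.exists_refines n
  exact ⟨fun n => Nat.rec Stage.init (fun n S => T S n) n, rfl, fun n => hT _ n⟩

/-- The rotation numbers of successively refined stages converge to an irrational number. -/
theorem exists_irrational_limit {S : ℕ → Stage} (hS : ∀ n, Stage.Refines n (S n) (S (n + 1))) :
    ∃ α : ℝ, Irrational α ∧
      Tendsto (fun n => ((S n).p / (S n).q : ℝ)) atTop (nhds α) := by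
  set a : ℕ → ℝ := fun n => ((S n).p / (S n).q : ℝ) with ha
  have hq : ∀ n, (0 : ℝ) < (S n).q := fun n => Nat.cast_pos.2 (S n).q_pos
  have hstep : ∀ n, a (n + 1) = a n + 1 / (S (n + 1)).q := fun n => (hS n).angle
  have hmono : StrictMono a := strictMono_nat_of_lt_succ fun n => by
    rw [hstep n]
    have := hq (n + 1)
    linarith [show 0 < 1 / ((S (n + 1)).q : ℝ) by positivity]
  have hupper : ∀ n : ℕ, a (n + 1) + 1 / (S (n + 1)).q ≤ a n + 1 / ((n + 2) * (S n).q) := by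
    intro n
    have h1 := hq n
    have h2 := hq (n + 1)
    have h3 : (2 * (n + 2) * (S n).q : ℝ) ≤ (S (n + 1)).q := by exact_mod_cast (hS n).q_le
    have h4 : 1 / ((S (n + 1)).q : ℝ) ≤ 1 / (2 * (n + 2) * (S n).q) :=
      one_div_le_one_div_of_le (by positivity) h3
    have h5 : 1 / ((n + 2) * (S n).q : ℝ) = 2 * (1 / (2 * (n + 2) * (S n).q)) := by field_simp
    rw [hstep n, h5]
    linarith
  have hanti : Antitone fun n => a n + 1 / (S n).q := antitone_nat_of_succ_le fun n => by
    refine (hupper n).trans ?_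
    have h1 := hq n
    gcongr
    nlinarith [(n.cast_nonneg : (0 : ℝ) ≤ n)]
  have hlt : ∀ m n, a m ≤ a n + 1 / (S n).q := by
    intro m n
    have h1 := hq (max m n)
    calc a m ≤ a (max m n) := hmono.monotone (le_max_left _ _)
      _ ≤ a (max m n) + 1 / (S (max m n)).q := by
        linarith [show 0 < 1 / ((S (max m n)).q : ℝ) by positivity]
      _ ≤ _ := hanti (le_max_right m n)
  have hbdd : BddAbove (range a) := ⟨a 0 + 1 / (S 0).q, by rintro _ ⟨m, rfl⟩; exact hlt m 0⟩
  refine ⟨⨆ n, a n, irrational_of_approx (p := fun n => (S n).p) (q := fun n => (S n).q)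
    (fun n => (S n).q_pos) (fun n => ?_) (fun n => ?_),
    tendsto_atTop_ciSup hmono.monotone hbdd⟩
  · exact (hmono n.lt_succ_self).trans_le (le_ciSup hbdd _)
  · exact (ciSup_le fun m => hlt m (n + 1)).trans (hupper n)

/-- The maps of successively refined stages converge uniformly. -/
theorem exists_limit_map {S : ℕ → Stage} (hS : ∀ n, Stage.Refines n (S n) (S (n + 1))) :
    ∃ F : ℂ → ℂ, ∀ n, ∀ z ∈ ball (0 : ℂ) 4, ‖F z - (S n).f z‖ ≤ 1 / 2 / 2 ^ n := by
  have hd : ∀ z ∈ ball (0 : ℂ) 4, ∀ n, dist ((S n).f z) ((S (n + 1)).f z) ≤ 1 / 2 / 2 / 2 ^ n := by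
    intro z hz n
    rw [dist_comm, dist_eq_norm]
    refine ((hS n).dist_le z hz).trans (le_of_eq ?_)
    rw [pow_add]; field_simp
  have hlim : ∀ z ∈ ball (0 : ℂ) 4, ∃ w, Tendsto (fun n => (S n).f z) atTop (nhds w) :=
    fun z hz => cauchySeq_tendsto_of_complete (cauchySeq_of_le_geometric_two (hd z hz))
  choose! F hF using hlim
  refine ⟨F, fun n z hz => ?_⟩
  rw [← dist_eq_norm, dist_comm]
  exact dist_le_of_le_geometric_two_of_tendsto (hd z hz) (hF z hz) n

/-- A holomorphic map that is uniformly close to the identity is injective on a smaller disk. -/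
theorem injOn_of_close_to_id {F : ℂ → ℂ} (hF : DifferentiableOn ℂ F (ball 0 4))
    (h : ∀ z ∈ ball (0 : ℂ) 4, ‖F z - z‖ ≤ 1 / 2) : InjOn F (ball 0 2) := by
  set g : ℂ → ℂ := fun z => F z - z with hg
  have hgd : DifferentiableOn ℂ g (ball 0 4) := hF.sub differentiableOn_id
  have hderiv : ∀ z ∈ ball (0 : ℂ) 2, ‖deriv g z‖ ≤ 1 / 2 := by
    intro z hz
    have hsub : closedBall z 1 ⊆ ball 0 4 := by
      intro w hw
      rw [mem_ball_zero_iff] at hz ⊢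
      rw [mem_closedBall, dist_eq_norm] at hw
      have := norm_add_le (w - z) z
      rw [sub_add_cancel] at this
      linarith
    have := norm_deriv_le_of_forall_mem_sphere_norm_le (c := z) (R := 1) (C := 1 / 2) (f := g) one_pos
      ((hgd.mono (closure_ball_subset_closedBall.trans hsub)).diffContOnCl)
      (fun w hw => h w (hsub (sphere_subset_closedBall hw)))
    simpa using this
  intro x hx y hy hxy
  have h1 := (convex_ball (0 : ℂ) 2).norm_image_sub_le_of_norm_deriv_le
    (fun z hz => hgd.differentiableAt (isOpen_ball.mem_nhds (ball_subset_ball (by norm_num) hz)))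
    hderiv hx hy
  have h2 : g y - g x = -(y - x) := by simp only [hg, hxy]; ring
  rw [h2, norm_neg] at h1
  have h3 : ‖y - x‖ = 0 := le_antisymm (by linarith) (norm_nonneg _)
  exact (sub_eq_zero.1 (norm_eq_zero.1 h3)).symm

/-- The uniform limit of maps preserving decreasing compact sets preserves their intersection. -/
theorem image_iInter_eq_of_tendstoUniformlyOn {X : Type*} [MetricSpace X] {K : ℕ → Set X}
    {f : ℕ → X → X} {F : X → X} (hanti : Antitone K) (hcomp : ∀ n, IsCompact (K n))
    (hf : ∀ n, f n '' K n = K n) (hFc : ContinuousOn F (K 0))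
    (hF : TendstoUniformlyOn f F atTop (K 0)) : F '' (⋂ n, K n) = ⋂ n, K n := by
  have h0 : ∀ n, K n ⊆ K 0 := fun n => hanti n.zero_le
  apply Subset.antisymm
  · rintro _ ⟨z, hz, rfl⟩
    rw [mem_iInter] at hz ⊢
    intro n
    refine (hcomp n).isClosed.mem_of_tendsto (hF.tendsto_at (hz 0)) ?_
    filter_upwards [eventually_ge_atTop n] with m hm
    exact hanti hm (hf m ▸ mem_image_of_mem _ (hz m))
  · intro w hw
    rw [mem_iInter] at hw
    have : ∀ m, ∃ x ∈ K m, f m x = w := fun m => by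
      have := hw m
      rwa [← hf m] at this
    choose x hx hxw using this
    obtain ⟨a, ha, σ, hσ, hlim⟩ := (hcomp 0).tendsto_subseq fun m => h0 m (hx m)
    refine ⟨a, mem_iInter.2 fun n => ?_, ?_⟩
    · refine (hcomp n).isClosed.mem_of_tendsto hlim ?_
      filter_upwards [hσ.tendsto_atTop.eventually_ge_atTop n] with m hm
      exact hanti hm (hx _)
    · have h1 : Tendsto (fun m => F (x (σ m))) atTop (nhds (F a)) :=
        (hFc a ha).tendsto.comp (tendsto_nhdsWithin_iff.2
          ⟨hlim, Eventually.of_forall fun m => h0 _ (hx _)⟩)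
      have h2 : Tendsto (fun m => F (x (σ m))) atTop (nhds w) := by
        rw [Metric.tendsto_nhds]
        intro ε hε
        filter_upwards [hσ.tendsto_atTop.eventually (Metric.tendstoUniformlyOn_iff.1 hF ε hε)]
          with m hm
        have := hm (x (σ m)) (h0 _ (hx _))
        rwa [hxw] at this
      exact tendsto_nhds_unique h1 h2

/-- The intersection of the disks of successively refined stages has positive area. -/
theorem volume_iInter_disk_pos {S : ℕ → Stage} (h0 : S 0 = Stage.init)
    (hS : ∀ n, Stage.Refines n (S n) (S (n + 1))) : 0 < volume (⋂ n, (S n).disk) := by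
  have hdisk : (S 0).disk = closedBall 0 1 := by rw [h0]; exact image_id _
  have hsub : closedBall (0 : ℂ) 1 ⊆
      (⋂ n, (S n).disk) ∪ ⋃ n, (S n).disk \ (S (n + 1)).disk := by
    intro z hz
    by_contra hcon
    simp only [mem_union, mem_iInter, mem_iUnion, Set.mem_sdiff, not_or, not_exists, not_and,
      not_not] at hcon
    refine hcon.1 fun n => ?_
    induction n with
    | zero => rwa [hdisk]
    | succ n ih => exact hcon.2 n ih
  have hsum : ∑' n : ℕ, ENNReal.ofReal (1 / 2 ^ (n + 1)) ≤ 1 := by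
    have h1 : HasSum (fun n : ℕ => (1 / 2 ^ (n + 1) : ℝ)) 1 := by
      convert hasSum_geometric_two' 1 using 2 with n
      rw [div_div, pow_succ']
    rw [← ENNReal.ofReal_tsum_of_nonneg (fun n => by positivity) h1.summable, h1.tsum_eq,
      ENNReal.ofReal_one]
  by_contra hcon
  have hz : volume (⋂ n, (S n).disk) = 0 := by simpa using hcon
  have h1 : volume (closedBall (0 : ℂ) 1) ≤ 1 := calc
    volume (closedBall (0 : ℂ) 1) ≤ volume (⋂ n, (S n).disk) +
        volume (⋃ n, (S n).disk \ (S (n + 1)).disk) := (measure_mono hsub).trans (measure_union_le _ _)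
    _ ≤ 0 + ∑' n, volume ((S n).disk \ (S (n + 1)).disk) := by
      rw [hz]; gcongr; exact measure_iUnion_le _
    _ ≤ 0 + ∑' n : ℕ, ENNReal.ofReal (1 / 2 ^ (n + 1)) := by
      gcongr with n; exact (hS n).volume_le
    _ ≤ 1 := by rwa [zero_add]
  rw [Complex.volume_closedBall, ENNReal.ofReal_one, one_pow, one_mul] at h1
  have h2 : Real.pi ≤ 1 := by exact_mod_cast h1
  linarith [Real.pi_gt_three]

/-- There exists a non-linearizable germ with a hedgehog of positive area. -/
theorem exists_hedgehog_positive_area :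
    ∃ (α r : ℝ) (f : ℂ → ℂ) (U K : Set ℂ),
      Irrational α ∧ 0 < r ∧
      IsOpen U ∧ Metric.closedBall (0 : ℂ) r ⊆ U ∧
      DifferentiableOn ℂ f U ∧ Set.InjOn f U ∧
      f 0 = 0 ∧ deriv f 0 = Complex.exp (2 * Real.pi * Complex.I * α) ∧
      ¬ Linearizable α f ∧
      IsHedgehog r f K ∧
      0 < MeasureTheory.volume K := by
  obtain ⟨S, hS0, hS⟩ := exists_stage_sequence
  obtain ⟨α, hα, hlimα⟩ := exists_irrational_limit hS
  obtain ⟨F, hF⟩ := exists_limit_map hS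
  have hunif : TendstoUniformlyOn (fun n => (S n).f) F atTop (ball 0 4) := by
    rw [Metric.tendstoUniformlyOn_iff]
    intro ε hε
    have h1 : Tendsto (fun n : ℕ => (1 / 2 : ℝ) * (1 / 2) ^ n) atTop (nhds (1 / 2 * 0)) :=
      (tendsto_pow_atTop_nhds_zero_of_lt_one (by norm_num) (by norm_num)).const_mul _
    rw [mul_zero] at h1
    filter_upwards [h1.eventually_lt_const hε] with n hn z hz
    rw [dist_eq_norm]
    refine (hF n z hz).trans_lt (lt_of_eq_of_lt ?_ hn)
    rw [one_div_pow]; ring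
  have hdiff : ∀ᶠ n in atTop, DifferentiableOn ℂ (S n).f (ball 0 4) :=
    Eventually.of_forall fun n => (S n).f_diff
  have hFd : DifferentiableOn ℂ F (ball 0 4) :=
    hunif.tendstoLocallyUniformlyOn.differentiableOn hdiff isOpen_ball
  have hFid : ∀ z ∈ ball (0 : ℂ) 4, ‖F z - z‖ ≤ 1 / 2 := by
    intro z hz
    have := hF 0 z hz
    rw [hS0] at this
    simpa [Stage.init] using this
  have hinj : InjOn F (ball 0 2) := injOn_of_close_to_id hFd hFid
  have h04 : (0 : ℂ) ∈ ball (0 : ℂ) 4 := by simp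
  have hF0 : F 0 = 0 := by
    have h1 := hunif.tendsto_at h04
    simp only [Stage.f_zero] at h1
    exact tendsto_nhds_unique h1 tendsto_const_nhds
  have hF' : deriv F 0 = exp (2 * Real.pi * I * α) := by
    have h1 := (hunif.tendstoLocallyUniformlyOn.deriv hdiff isOpen_ball).tendsto_at h04
    have h2 : Tendsto (fun n => deriv (S n).f 0) atTop (nhds (exp (2 * Real.pi * I * α))) := by
      simp only [Stage.deriv_f_zero]
      have hc : Continuous fun x : ℝ => exp (2 * Real.pi * I * x) := by fun_prop
      exact (hc.tendsto α).comp hlimα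
    exact tendsto_nhds_unique h1 h2
  obtain ⟨K, hK⟩ : ∃ K, K = ⋂ n, (S n).disk := ⟨_, rfl⟩
  have hanti : Antitone fun n => (S n).disk := antitone_nat_of_succ_le fun n => (hS n).disk_subset
  have hKn : ∀ n, K ⊆ (S n).disk := fun n => hK ▸ iInter_subset _ n
  have hKcomp : IsCompact K := (S 0).isCompact_disk.of_isClosed_subset
    (hK ▸ isClosed_iInter fun n => (S n).isCompact_disk.isClosed) (hKn 0)
  have hKpre : IsPreconnected K := hK ▸ isPreconnected_iInter_of_antitone hanti
    (fun n => (S n).isCompact_disk) fun n => (S n).isPreconnected_disk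
  have h0K : (0 : ℂ) ∈ K := hK ▸ mem_iInter.2 fun n => (S n).zero_mem_disk
  have hK1 : K ⊆ closedBall 0 1 := (hKn 0).trans (S 0).disk_subset_closedBall
  have hvol : 0 < volume K := hK ▸ volume_iInter_disk_pos hS0 hS
  have h14 : closedBall (0 : ℂ) 1 ⊆ ball 0 4 := closedBall_subset_ball (by norm_num)
  have hFK : F '' K = K := by
    rw [hK]
    exact image_iInter_eq_of_tendstoUniformlyOn hanti (fun n => (S n).isCompact_disk)
      (fun n => (S n).image_disk)
      (hFd.continuousOn.mono ((S 0).disk_subset_closedBall.trans h14))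
      (hunif.mono ((S 0).disk_subset_closedBall.trans h14))
  have hKc : IsConnected Kᶜ := by
    rw [hK, compl_iInter]
    refine IsConnected.iUnion_of_chain (fun n => (S n).isConnected_compl_disk) fun n => ⟨5, ?_, ?_⟩
    all_goals
      intro h
      have := mem_closedBall_zero_iff.1 (Stage.disk_subset_closedBall _ h)
      norm_num at this
  obtain ⟨k, hk, hmax⟩ := hKcomp.exists_isMaxOn ⟨0, h0K⟩ continuous_norm.continuousOn
  have hk0 : k ≠ 0 := by
    rintro rfl
    have hsub : K ⊆ {0} := fun z hz => by
      have : ‖z‖ ≤ ‖(0 : ℂ)‖ := hmax hz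
      rw [norm_zero] at this
      exact norm_le_zero_iff.1 this
    exact hvol.ne' (measure_mono_null hsub (measure_singleton _))
  have hk1 : ‖k‖ ≤ 1 := mem_closedBall_zero_iff.1 (hK1 hk)
  refine ⟨α, ‖k‖, F, ball 0 2, K, hα, norm_pos_iff.2 hk0, isOpen_ball,
    closedBall_subset_ball (by linarith), hFd.mono (ball_subset_ball (by norm_num)), hinj, hF0, hF',
    fun hlin => ?_, ⟨hKcomp, ⟨⟨0, h0K⟩, hKpre⟩, h0K,
      fun z hz => mem_closedBall_zero_iff.2 (hmax hz), ⟨k, hk, by simp⟩, hFK, hKc⟩, hvol⟩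
  have hnhds := mem_nhds_of_linearizable hα hKcomp.isClosed hKpre h0K hk hk0 isOpen_ball hinj
    (hK1.trans (closedBall_subset_ball (by norm_num))) hFK hlin
  obtain ⟨ε, hε, hball⟩ := Metric.mem_nhds_iff.1 hnhds
  obtain ⟨n, hn⟩ := exists_nat_one_div_lt hε
  obtain ⟨z, hz, hzn⟩ := (hS n).exists_notMem
  exact hz (hKn (n + 1) (hball (mem_ball_zero_iff.2 (hzn.trans hn))))
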